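/- arXiv:1401.3086 — 2 statements merged into one kernel-verified Lean document; each statement's English description precedes it below -/
import Mathlib

section
/- For every vertex u of Γ, the pointwise stabilizer G_u^{[4]} of the ball of radius 4 around u is trivial. -/
open MulAction Pointwise

/-- `V`, the `n`-dimensional vector space over the field with 3 elements. -/
abbrev Vec (n : ℕ) := Fin n → ZMod 3

/-- The translation subgroup `V` of `Perm (Vec n)`. -/
def TransGrp (n : ℕ) : Subgroup (Equiv.Perm (Vec n)) :=
  Subgroup.closure {f : Equiv.Perm (Vec n) | ∃ w, ∀ v, f v = v + w}

/-- The Frobenius group `L = V ⋊ C₂` of order `2·3^n`, acting on `V = Vec n`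
by `v ↦ ε·v + w` with `ε = ±1`: it is generated by the translations and negation. -/
def Lgrp (n : ℕ) : Subgroup (Equiv.Perm (Vec n)) :=
  Subgroup.closure ({f : Equiv.Perm (Vec n) | ∃ w, ∀ v, f v = v + w} ∪ {Equiv.neg (Vec n)})

/-- The pointwise stabilizer `G_u^{[s]}` in `G` of the ball of radius `s` around `u`. -/
def ballStab {α : Type*} (Γ : SimpleGraph α) (G : Type*) [Group G] [MulAction G α]
    (u : α) (s : ℕ) : Subgroup G :=
  ⨅ w ∈ {w : α | Γ.dist u w ≤ s}, stabilizer G w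

/-- `Z_{uw} = Ω₁(Z(G_u ∩ G_w))`, the subgroup generated by the elements of order at most 2
of the centre of the arc stabilizer `G_u ∩ G_w`. -/
def Zuw {α : Type*} (G : Type*) [Group G] [MulAction G α] (u w : α) : Subgroup G :=
  Subgroup.closure {g : G |
    g ∈ (stabilizer G u ⊓ stabilizer G w) ⊓
        Subgroup.centralizer ((stabilizer G u ⊓ stabilizer G w : Subgroup G) : Set G) ∧ g ^ 2 = 1}

/-- `Z_u = ⟨Z_{uw}^{G_u}⟩`, the normal closure in `G_u` of the subgroups `Z_{uw}`,
for `w` a neighbour of `u` (independent of the choice of `w` by arc-transitivity). -/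
def Zsub {α : Type*} (Γ : SimpleGraph α) (G : Type*) [Group G] [MulAction G α]
    (u : α) : Subgroup G :=
  Subgroup.closure {k : G | ∃ h ∈ stabilizer G u, ∃ w ∈ Γ.neighborSet u,
    ∃ g ∈ Zuw G u w, k = h * g * h⁻¹}

/-- The critical distance `b = min { d(u,v) : Z_u ≰ G_v^{[1]} }`. -/
noncomputable def critDist {α : Type*} (Γ : SimpleGraph α) (G : Type*) [Group G]
    [MulAction G α] : ℕ :=
  sInf {d : ℕ | ∃ u v : α, Γ.dist u v = d ∧ ¬ Zsub Γ G u ≤ ballStab Γ G v 1}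

/-- `(u,v)` is a critical pair: `d(u,v) = b` and `Z_u ≰ G_v^{[1]}`. -/
def critPair {α : Type*} (Γ : SimpleGraph α) (G : Type*) [Group G] [MulAction G α]
    (u v : α) : Prop :=
  Γ.dist u v = critDist Γ G ∧ ¬ Zsub Γ G u ≤ ballStab Γ G v 1

/-- `(Γ, G)` is locally `L`: for each vertex `u` there is a bijection
`φ : Γ(u) ≃ V` conjugating the permutation group induced by `G_u` on `Γ(u)`
to exactly the permutation group `L` acting on `V`. -/
def LocallyL {α : Type*} (n : ℕ) (Γ : SimpleGraph α) (G : Type*) [Group G]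
    [MulAction G α] : Prop :=
  ∀ u : α, ∃ φ : Γ.neighborSet u ≃ Vec n,
    (∀ g ∈ stabilizer G u, ∃ l ∈ Lgrp n, ∀ z : Γ.neighborSet u,
      ∃ hz : (g • (z : α)) ∈ Γ.neighborSet u, φ ⟨g • (z : α), hz⟩ = l (φ z)) ∧
    (∀ l ∈ Lgrp n, ∃ g ∈ stabilizer G u, ∀ z : Γ.neighborSet u,
      ∃ hz : (g • (z : α)) ∈ Γ.neighborSet u, φ ⟨g • (z : α), hz⟩ = l (φ z))

section LocallyReflective

open scoped commutatorElement

theorem exists_eq_add_or_sub_of_mem_Lgrp {n : ℕ} {l : Equiv.Perm (Vec n)} (hl : l ∈ Lgrp n) :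
    ∃ c, (∀ v, l v = v + c) ∨ (∀ v, l v = c - v) := by
  induction hl using Subgroup.closure_induction with
  | mem f hf =>
    rcases hf with ⟨w, hw⟩ | rfl
    · exact ⟨w, Or.inl hw⟩
    · exact ⟨0, Or.inr fun v => by simp⟩
  | one => exact ⟨0, Or.inl fun v => by simp⟩
  | mul f g _ _ hf hg =>
    obtain ⟨c, hc⟩ := hf
    obtain ⟨d, hd⟩ := hg
    rcases hc with hc | hc <;> rcases hd with hd | hd
    · exact ⟨d + c, Or.inl fun v => by simp [hc, hd, add_assoc]⟩
    · exact ⟨d + c, Or.inr fun v => by simp only [Equiv.Perm.mul_apply, hc, hd]; abel⟩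
    · exact ⟨c - d, Or.inr fun v => by simp only [Equiv.Perm.mul_apply, hc, hd]; abel⟩
    · exact ⟨c - d, Or.inl fun v => by simp only [Equiv.Perm.mul_apply, hc, hd]; abel⟩
  | inv f _ hf =>
    obtain ⟨c, hc⟩ := hf
    rcases hc with hc | hc
    · exact ⟨-c, Or.inl fun v => by rw [Equiv.Perm.inv_eq_iff_eq, hc]; simp⟩
    · exact ⟨c, Or.inr fun v => by rw [Equiv.Perm.inv_eq_iff_eq, hc]; simp⟩

theorem exists_mem_Lgrp_eq_sub {n : ℕ} (c : Vec n) : ∃ l ∈ Lgrp n, ∀ v, l v = c - v := by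
  refine ⟨Equiv.addRight c * Equiv.neg (Vec n),
    mul_mem (Subgroup.subset_closure (Or.inl ⟨c, fun v => rfl⟩))
      (Subgroup.subset_closure (Or.inr rfl)), fun v => ?_⟩
  simp [sub_eq_neg_add]

variable {α : Type*} {Γ : SimpleGraph α} {G : Type*} [Group G] [MulAction G α]

/-- A local coordinate system `Γ(u) → V` in which `G_u` acts by the maps `v ↦ ±v + c`. -/
theorem LocallyL.exists_coord {n : ℕ} (hloc : LocallyL n Γ G) (u : α) :
    ∃ φ : α → Vec n,
      (∀ z z', Γ.Adj u z → Γ.Adj u z' → φ z = φ z' → z = z') ∧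
      (∀ v, ∃ z, Γ.Adj u z ∧ φ z = v) ∧
      (∀ g ∈ stabilizer G u, ∃ c,
        (∀ z, Γ.Adj u z → φ (g • z) = φ z + c) ∨ (∀ z, Γ.Adj u z → φ (g • z) = c - φ z)) ∧
      (∀ c, ∃ g ∈ stabilizer G u, ∀ z, Γ.Adj u z → φ (g • z) = c - φ z) := by
  classical
  obtain ⟨φ, h1, h2⟩ := hloc u
  have key : ∀ z (hz : Γ.Adj u z),
      (fun z => if h : Γ.Adj u z then φ ⟨z, h⟩ else 0) z = φ ⟨z, hz⟩ := fun z hz => dif_pos hz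
  refine ⟨fun z => if h : Γ.Adj u z then φ ⟨z, h⟩ else 0, fun z z' hz hz' e => ?_, fun v => ?_,
    fun g hg => ?_, fun c => ?_⟩
  · rw [key z hz, key z' hz'] at e
    exact congrArg Subtype.val (φ.injective e)
  · exact ⟨φ.symm v, (φ.symm v).2, by rw [key _ (φ.symm v).2]; simp⟩
  · obtain ⟨l, hl, h⟩ := h1 g hg
    obtain ⟨c, hc⟩ := exists_eq_add_or_sub_of_mem_Lgrp hl
    refine ⟨c, hc.imp (fun hc z hz => ?_) (fun hc z hz => ?_)⟩ <;>
    · obtain ⟨hz', e⟩ := h ⟨z, hz⟩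
      rw [key z hz, key _ hz', e, hc]
  · obtain ⟨l, hl, hc⟩ := exists_mem_Lgrp_eq_sub c
    obtain ⟨g, hg, h⟩ := h2 l hl
    refine ⟨g, hg, fun z hz => ?_⟩
    obtain ⟨hz', e⟩ := h ⟨z, hz⟩
    rw [key z hz, key _ hz', e, hc]

/-- The stabilizer in `G` of the arc `(u, w)`. -/
abbrev arcStab (G : Type*) [Group G] [MulAction G α] (u w : α) : Subgroup G :=
  stabilizer G u ⊓ stabilizer G w

theorem mem_ballStab {u : α} {s : ℕ} {g : G} :
    g ∈ ballStab Γ G u s ↔ ∀ w, Γ.dist u w ≤ s → g • w = w := by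
  simp [ballStab, Subgroup.mem_iInf]

theorem mem_ballStab_one (hconn : Γ.Connected) {u : α} {g : G} :
    g ∈ ballStab Γ G u 1 ↔ g • u = u ∧ ∀ w, Γ.Adj u w → g • w = w := by
  rw [mem_ballStab]
  constructor
  · exact fun h => ⟨h u (by simp), fun w hw => h w (SimpleGraph.dist_eq_one_iff_adj.2 hw).le⟩
  · rintro ⟨h0, h1⟩ w hw
    rcases Nat.le_one_iff_eq_zero_or_eq_one.1 hw with hw | hw
    · rwa [← hconn.dist_eq_zero_iff.1 hw]
    · exact h1 w (SimpleGraph.dist_eq_one_iff_adj.1 hw)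

/-- An arc-transitive group with finite vertex stabilizers acting faithfully on a connected graph
such that the elements of each arc stabilizer `G_u ∩ G_w` outside `G_u^{[1]}` act on `Γ(u)` as the
point reflections `v ↦ 2w - v` of a vector space over the field with three elements. -/
structure IsLocallyReflective (Γ : SimpleGraph α) (G : Type*) [Group G] [MulAction G α] :
    Prop where
  conn : Γ.Connected
  aut : ∀ (g : G) (u w : α), Γ.Adj u w ↔ Γ.Adj (g • u) (g • w)
  faith : ∀ g : G, (∀ u : α, g • u = u) → g = 1
  arc : ∀ u w u' w' : α, Γ.Adj u w → Γ.Adj u' w' → ∃ g : G, g • u = u' ∧ g • w = w'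
  fin : ∀ u : α, Finite (stabilizer G u)
  exists_adj : ∀ u, ∃ w, Γ.Adj u w
  reflection_mul_mem : ∀ {u w : α} {g g' : G}, Γ.Adj u w → g ∈ arcStab G u w → g' ∈ arcStab G u w →
    g ∉ ballStab Γ G u 1 → g' ∉ ballStab Γ G u 1 → g * g' ∈ ballStab Γ G u 1
  exists_reflection : ∀ {u w : α}, Γ.Adj u w → ∃ g ∈ arcStab G u w, g ∉ ballStab Γ G u 1
  exists_midpoint : ∀ {u c d : α}, Γ.Adj u c → Γ.Adj u d → c ≠ d →
    ∃ m, Γ.Adj u m ∧ ∀ g ∈ arcStab G u m, g ∉ ballStab Γ G u 1 → g • c = d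
  cube_mem : ∀ {u w x : α} {s t : G}, Γ.Adj u w → Γ.Adj u x → s ∈ arcStab G u w →
    t ∈ arcStab G u x → s ∉ ballStab Γ G u 1 → t ∉ ballStab Γ G u 1 →
    (s * t) ^ 3 ∈ ballStab Γ G u 1
  conj_mul_mem : ∀ {u w x y : α} {s t r : G}, Γ.Adj u w → Γ.Adj u x → Γ.Adj u y →
    s ∈ arcStab G u w → t ∈ arcStab G u x → r ∈ arcStab G u y → s ∉ ballStab Γ G u 1 →
    t ∉ ballStab Γ G u 1 → r ∉ ballStab Γ G u 1 →
    r * (s * t) * r⁻¹ * (s * t) ∈ ballStab Γ G u 1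

theorem Vec.add_add_self {n : ℕ} (v : Vec n) : v + v + v = 0 := by
  ext i
  have : ∀ a : ZMod 3, a + a + a = 0 := by decide
  exact this (v i)

theorem LocallyL.isLocallyReflective {n : ℕ} (hn : n ≠ 0) (hconn : Γ.Connected)
    (haut : ∀ (g : G) (u w : α), Γ.Adj u w ↔ Γ.Adj (g • u) (g • w))
    (hfaith : ∀ g : G, (∀ u : α, g • u = u) → g = 1)
    (harc : ∀ u w u' w' : α, Γ.Adj u w → Γ.Adj u' w' → ∃ g : G, g • u = u' ∧ g • w = w')
    (hfin : ∀ u : α, Finite (stabilizer G u)) (hloc : LocallyL n Γ G) :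
    IsLocallyReflective Γ G := by
  have : NeZero n := ⟨hn⟩
  have adj : ∀ {u : α} {g : G}, g ∈ stabilizer G u → ∀ {z}, Γ.Adj u z → Γ.Adj u (g • z) := by
    intro u g hg z hz
    have := (haut g u z).1 hz
    rwa [mem_stabilizer_iff.1 hg] at this
  choose φ inj surj act refl using hloc.exists_coord
  have mem : ∀ {u : α} {g : G}, g ∈ stabilizer G u → (∀ z, Γ.Adj u z → φ u (g • z) = φ u z) →
      g ∈ ballStab Γ G u 1 := fun {u g} hg h =>
    (mem_ballStab_one hconn).2 ⟨hg, fun w hw => inj u _ _ (adj hg hw) hw (h w hw)⟩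
  have key : ∀ {u w : α} {g : G}, Γ.Adj u w → g ∈ arcStab G u w → g ∉ ballStab Γ G u 1 →
      ∀ z, Γ.Adj u z → φ u (g • z) = φ u w + φ u w - φ u z := by
    intro u w g hw hg hg' z hz
    obtain ⟨c, hc | hc⟩ := act u g hg.1
    · refine absurd (mem hg.1 fun z hz => ?_) hg'
      have := hc w hw
      rw [mem_stabilizer_iff.1 hg.2, left_eq_add] at this
      rw [hc z hz, this, add_zero]
    · have := hc w hw
      rw [mem_stabilizer_iff.1 hg.2] at this
      rw [hc z hz, eq_sub_iff_add_eq.1 this]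
  have inv : ∀ {u w : α} {g : G}, g ∈ arcStab G u w → g ∉ ballStab Γ G u 1 →
      g⁻¹ ∈ arcStab G u w ∧ g⁻¹ ∉ ballStab Γ G u 1 := fun hg hg' =>
    ⟨inv_mem hg, fun h => hg' (by simpa using inv_mem h)⟩
  refine ⟨hconn, haut, hfaith, harc, hfin, fun u => (surj u 0).imp fun _ h => h.1,
    fun {u w g g'} hw hg hg' h h' => ?_, fun {u w} hw => ?_, fun {u c d} hc hd hcd => ?_,
    fun {u w x s t} hw hx hs ht hs' ht' => ?_,
    fun {u w x y s t r} hw hx hy hs ht hr hs' ht' hr' => ?_⟩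
  · refine mem (mul_mem hg.1 hg'.1) fun z hz => ?_
    rw [mul_smul, key hw hg h _ (adj hg'.1 hz), key hw hg' h' _ hz]
    abel
  · obtain ⟨g, hg, h⟩ := refl u (φ u w + φ u w)
    refine ⟨g, ⟨hg, inj u _ _ (adj hg hw) hw ?_⟩, fun hg' => ?_⟩
    · rw [h w hw]; abel
    · obtain ⟨z, hz, e⟩ := surj u (φ u w + 1)
      have := h z hz
      rw [((mem_ballStab_one hconn).1 hg').2 z hz, e] at this
      have h2 : (1 : Vec n) + 1 = φ u w + 1 - (φ u w + φ u w - (φ u w + 1)) := by abel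
      rw [sub_eq_zero.2 this] at h2
      exact absurd (congrFun h2 0) (by decide : (1 : ZMod 3) + 1 ≠ 0)
  · obtain ⟨m, hm, e⟩ := surj u (-(φ u c + φ u d))
    refine ⟨m, hm, fun g hg hg' => inj u _ _ (adj hg.1 hc) hd ?_⟩
    rw [key hm hg hg' c hc, e, ← sub_eq_zero]
    have h1 := Vec.add_add_self (φ u c)
    have h2 := Vec.add_add_self (φ u d)
    calc _ = -(φ u c + φ u c + φ u c) - (φ u d + φ u d + φ u d) := by abel
      _ = 0 := by rw [h1, h2]; simp
  · have h1 : ∀ z, Γ.Adj u z → φ u ((s * t) • z) = φ u z +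
        (φ u w + φ u w - φ u x - φ u x) := fun z hz => by
      rw [mul_smul, key hw hs hs' _ (adj ht.1 hz), key hx ht ht' _ hz]; abel
    have hst := mul_mem hs.1 ht.1
    refine mem (pow_mem hst 3) fun z hz => ?_
    rw [pow_three, mul_smul, h1 _ (adj (mul_mem hst hst) hz), mul_smul, h1 _ (adj hst hz), h1 _ hz,
      add_assoc, add_assoc, ← add_assoc (φ u w + φ u w - φ u x - φ u x), Vec.add_add_self, add_zero]
  · have hst := mul_mem hs.1 ht.1
    have hri := inv hr hr'
    refine mem (mul_mem (mul_mem (mul_mem hr.1 hst) (inv_mem hr.1)) hst) fun z hz => ?_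
    simp only [mul_smul]
    have a1 := adj ht.1 hz
    have a2 := adj hs.1 a1
    have a3 := adj hri.1.1 a2
    have a4 := adj ht.1 a3
    have a5 := adj hs.1 a4
    rw [key hy hr hr' _ a5, key hw hs hs' _ a4, key hx ht ht' _ a3, key hy hri.1 hri.2 _ a2,
      key hw hs hs' _ a1, key hx ht ht' _ hz]
    abel

theorem conj_mem_stabilizer {u : α} {x : G} (g : G) (hx : x ∈ stabilizer G u) :
    g * x * g⁻¹ ∈ stabilizer G (g • u) := by
  rw [mem_stabilizer_iff] at *
  rw [mul_smul, inv_smul_smul, mul_smul, hx]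

theorem conj_mem_arcStab {u w : α} {x : G} (g : G) (hx : x ∈ arcStab G u w) :
    g * x * g⁻¹ ∈ arcStab G (g • u) (g • w) :=
  ⟨conj_mem_stabilizer g hx.1, conj_mem_stabilizer g hx.2⟩

theorem arcStab_comm (u w : α) : arcStab G u w = arcStab G w u := inf_comm _ _

theorem Zuw_comm (u w : α) : Zuw G u w = Zuw G w u := by
  simp only [Zuw, inf_comm (stabilizer G u)]

theorem mem_Zuw {u w : α} {x : G} :
    x ∈ Zuw G u w ↔ x ∈ arcStab G u w ∧ (∀ y ∈ arcStab G u w, Commute y x) ∧ x ^ 2 = 1 := by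
  constructor
  · intro hx
    induction hx using Subgroup.closure_induction with
    | mem x hx => exact ⟨hx.1.1, fun y hy => Subgroup.mem_centralizer_iff.1 hx.1.2 y hy, hx.2⟩
    | one => exact ⟨one_mem _, fun y _ => Commute.one_right y, one_pow 2⟩
    | mul a b _ _ ha hb =>
      refine ⟨mul_mem ha.1 hb.1, fun y hy => (ha.2.1 y hy).mul_right (hb.2.1 y hy), ?_⟩
      rw [(hb.2.1 a ha.1).mul_pow, ha.2.2, hb.2.2, one_mul]
    | inv a _ ha => exact ⟨inv_mem ha.1, fun y hy => (ha.2.1 y hy).inv_right, by simp [ha.2.2]⟩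
  · rintro ⟨h1, h2, h3⟩
    exact Subgroup.subset_closure ⟨⟨h1, Subgroup.mem_centralizer_iff.2 h2⟩, h3⟩

theorem conj_mem_Zuw {u w : α} {x : G} (g : G) (hx : x ∈ Zuw G u w) :
    g * x * g⁻¹ ∈ Zuw G (g • u) (g • w) := by
  rw [mem_Zuw] at *
  refine ⟨conj_mem_arcStab g hx.1, fun y hy => ?_, by rw [conj_pow, hx.2.2]; simp⟩
  have h1 := conj_mem_arcStab g⁻¹ hy
  rw [inv_smul_smul, inv_smul_smul, inv_inv] at h1
  have h2 := (hx.2.1 _ h1).map (MulAut.conj g)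
  simpa [mul_assoc] using h2

theorem conj_mem_Zuw_iff {u w : α} {x : G} (g : G) :
    g * x * g⁻¹ ∈ Zuw G (g • u) (g • w) ↔ x ∈ Zuw G u w := by
  refine ⟨fun hx => ?_, conj_mem_Zuw g⟩
  have := conj_mem_Zuw g⁻¹ hx
  rw [inv_smul_smul, inv_smul_smul] at this
  simpa [mul_assoc] using this

theorem Zuw_le_Zsub {u w : α} (hw : Γ.Adj u w) : Zuw G u w ≤ Zsub Γ G u := fun x hx =>
  Subgroup.subset_closure ⟨1, one_mem _, w, hw, x, hx, by simp⟩

namespace IsLocallyReflective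

theorem adj_smul (h : IsLocallyReflective Γ G) (g : G) {u w : α} (hw : Γ.Adj u w) :
    Γ.Adj (g • u) (g • w) :=
  (h.aut g u w).1 hw

theorem dist_smul_le (h : IsLocallyReflective Γ G) (g : G) (u w : α) :
    Γ.dist (g • u) (g • w) ≤ Γ.dist u w := by
  obtain ⟨p, hp⟩ := h.conn.exists_walk_length_eq_dist u w
  let f : Γ →g Γ := ⟨fun x => g • x, fun a => h.adj_smul g a⟩
  have := SimpleGraph.dist_le (p.map f)
  rwa [SimpleGraph.Walk.length_map, hp] at this

theorem conj_mem_ballStab (h : IsLocallyReflective Γ G) {u : α} {s : ℕ} {x : G} (g : G)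
    (hx : x ∈ ballStab Γ G u s) : g * x * g⁻¹ ∈ ballStab Γ G (g • u) s := by
  rw [mem_ballStab] at *
  intro w hw
  have := h.dist_smul_le g⁻¹ (g • u) w
  rw [inv_smul_smul] at this
  rw [mul_smul, mul_smul, hx _ (this.trans hw), smul_inv_smul]

theorem conj_mem_ballStab_self (h : IsLocallyReflective Γ G) {u : α} {s : ℕ} {x g : G}
    (hg : g ∈ stabilizer G u) (hx : x ∈ ballStab Γ G u s) : g * x * g⁻¹ ∈ ballStab Γ G u s := by
  have := h.conj_mem_ballStab g hx
  rwa [mem_stabilizer_iff.1 hg] at this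

theorem notMem_conj_ballStab (h : IsLocallyReflective Γ G) {u : α} {s : ℕ} {x : G} (g : G)
    (hx : x ∉ ballStab Γ G u s) : g * x * g⁻¹ ∉ ballStab Γ G (g • u) s := by
  intro h1
  have := h.conj_mem_ballStab g⁻¹ h1
  rw [inv_smul_smul] at this
  exact hx (by simpa [mul_assoc] using this)

theorem conj_mem_Zsub (h : IsLocallyReflective Γ G) {u : α} {x : G} (g : G)
    (hx : x ∈ Zsub Γ G u) : g * x * g⁻¹ ∈ Zsub Γ G (g • u) := by
  induction hx using Subgroup.closure_induction with
  | mem x hx =>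
    obtain ⟨k, hk, w, hw, y, hy, rfl⟩ := hx
    exact Subgroup.subset_closure ⟨g * k * g⁻¹, conj_mem_stabilizer g hk, g • w,
      h.adj_smul g hw, g * y * g⁻¹, conj_mem_Zuw g hy, by group⟩
  | one => simp
  | mul a b _ _ ha hb => rw [← conj_mul]; exact mul_mem ha hb
  | inv a _ ha => rw [← conj_inv]; exact inv_mem ha

theorem conj_mem_Zsub_self (h : IsLocallyReflective Γ G) {u : α} {x g : G}
    (hg : g ∈ stabilizer G u) (hx : x ∈ Zsub Γ G u) : g * x * g⁻¹ ∈ Zsub Γ G u := by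
  have := h.conj_mem_Zsub g hx
  rwa [mem_stabilizer_iff.1 hg] at this

theorem commutator_mem_Zsub (h : IsLocallyReflective Γ G) {u : α} {x g : G}
    (hg : g ∈ stabilizer G u) (hx : x ∈ Zsub Γ G u) : ⁅g, x⁆ ∈ Zsub Γ G u :=
  mul_mem (h.conj_mem_Zsub_self hg hx) (inv_mem hx)

theorem ballStab_one_le_arcStab (h : IsLocallyReflective Γ G) {u w : α} (hw : Γ.Adj u w) :
    ballStab Γ G u 1 ≤ arcStab G u w := fun _ hg =>
  ⟨((mem_ballStab_one h.conn).1 hg).1, ((mem_ballStab_one h.conn).1 hg).2 w hw⟩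

theorem commute_Zsub (h : IsLocallyReflective Γ G) {u : α} {q z : G}
    (hq : q ∈ ballStab Γ G u 1) (hz : z ∈ Zsub Γ G u) : Commute q z := by
  induction hz using Subgroup.closure_induction with
  | mem x hx =>
    obtain ⟨k, hk, w, hw, y, hy, rfl⟩ := hx
    have h1 := h.conj_mem_ballStab_self (inv_mem hk) hq
    have h2 := ((mem_Zuw.1 hy).2.1 _ (h.ballStab_one_le_arcStab hw h1)).map (MulAut.conj k)
    simpa [mul_assoc] using h2
  | one => exact Commute.one_right q
  | mul a b _ _ ha hb => exact ha.mul_right hb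
  | inv a _ ha => exact ha.inv_right

theorem exists_stabilizer_smul_eq (h : IsLocallyReflective Γ G) {u w w' : α} (hw : Γ.Adj u w)
    (hw' : Γ.Adj u w') : ∃ g ∈ stabilizer G u, g • w = w' :=
  h.arc u w u w' hw hw'

theorem inv_mul_mem (h : IsLocallyReflective Γ G) {u w : α} {g g' : G} (hw : Γ.Adj u w)
    (hg : g ∈ arcStab G u w) (hg' : g' ∈ arcStab G u w) (h1 : g ∉ ballStab Γ G u 1)
    (h2 : g' ∉ ballStab Γ G u 1) : g⁻¹ * g' ∈ ballStab Γ G u 1 :=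
  h.reflection_mul_mem hw (inv_mem hg) hg' (fun h3 => h1 (by simpa using inv_mem h3)) h2

theorem arcStab_le (h : IsLocallyReflective Γ G) {u w : α} {t : G} {K : Subgroup G}
    (hw : Γ.Adj u w) (ht : t ∈ arcStab G u w) (ht' : t ∉ ballStab Γ G u 1)
    (hQ : ballStab Γ G u 1 ≤ K) (htK : t ∈ K) : arcStab G u w ≤ K := fun g hg => by
  by_cases hg' : g ∈ ballStab Γ G u 1
  · exact hQ hg'
  · have := mul_mem htK (hQ (h.inv_mul_mem hw ht hg ht' hg'))
    rwa [mul_inv_cancel_left] at this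

/-- A vertex stabilizer is generated by one arc stabilizer and one reflection at each neighbour. -/
theorem stabilizer_le (h : IsLocallyReflective Γ G) {u w : α} {K : Subgroup G} (hw : Γ.Adj u w)
    (hK : arcStab G u w ≤ K)
    (hr : ∀ m, Γ.Adj u m → ∃ t ∈ K, t ∈ arcStab G u m ∧ t ∉ ballStab Γ G u 1) :
    stabilizer G u ≤ K := fun g hg => by
  have hgw : Γ.Adj u (g • w) := by
    have := h.adj_smul g hw
    rwa [mem_stabilizer_iff.1 hg] at this
  by_cases e : w = g • w
  · exact hK ⟨hg, e.symm⟩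
  · obtain ⟨m, hm, hm'⟩ := h.exists_midpoint hw hgw e
    obtain ⟨t, htK, ht, ht'⟩ := hr m hm
    have h1 : t⁻¹ * g ∈ arcStab G u w := by
      refine ⟨(stabilizer G u).mul_mem ((stabilizer G u).inv_mem ht.1) hg, mem_stabilizer_iff.2 ?_⟩
      rw [mul_smul, ← hm' t ht ht', inv_smul_smul]
    have := mul_mem htK (hK h1)
    rwa [mul_inv_cancel_left] at this

theorem stabilizer_le_of_forall (h : IsLocallyReflective Γ G) {u : α} {K : Subgroup G}
    (hK : ∀ w, Γ.Adj u w → arcStab G u w ≤ K) : stabilizer G u ≤ K := by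
  obtain ⟨w, hw⟩ := h.exists_adj u
  refine h.stabilizer_le hw (hK w hw) fun m hm => ?_
  obtain ⟨t, ht, ht'⟩ := h.exists_reflection hm
  exact ⟨t, hK m hm ht, ht, ht'⟩

/-- A subgroup of an arc stabilizer normalized by both vertex stabilizers is trivial. -/
theorem eq_bot_of_normalized (h : IsLocallyReflective Γ G) {u v : α} (huv : Γ.Adj u v)
    {N : Subgroup G} (hN : N ≤ arcStab G u v)
    (hu : ∀ g ∈ stabilizer G u, ∀ x ∈ N, g * x * g⁻¹ ∈ N)
    (hv : ∀ g ∈ stabilizer G v, ∀ x ∈ N, g * x * g⁻¹ ∈ N) : N = ⊥ := by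
  have step : ∀ y z, Γ.Adj y z → N ≤ stabilizer G y →
      (∀ g ∈ stabilizer G y, ∀ x ∈ N, g * x * g⁻¹ ∈ N) →
      (∀ g ∈ stabilizer G z, ∀ x ∈ N, g * x * g⁻¹ ∈ N) →
      ∀ r, Γ.Adj z r → N ≤ stabilizer G r ∧
        ∀ g ∈ stabilizer G r, ∀ x ∈ N, g * x * g⁻¹ ∈ N := by
    intro y z hyz h1 h2 h3 r hr
    obtain ⟨k, hk, rfl⟩ := h.exists_stabilizer_smul_eq hyz.symm hr
    have hback : ∀ x ∈ N, k⁻¹ * x * k ∈ N := fun x hx => by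
      simpa using h3 k⁻¹ (inv_mem hk) x hx
    constructor
    · intro x hx
      have := conj_mem_stabilizer k (h1 (hback x hx))
      simpa [mul_assoc] using this
    · intro g hg x hx
      have hg' := conj_mem_stabilizer k⁻¹ hg
      rw [inv_smul_smul] at hg'
      have := h3 k hk _ (h2 _ hg' _ (hback x hx))
      simpa [mul_assoc] using this
  have key : ∀ z, Γ.Reachable v z → (N ≤ stabilizer G z ∧
      ∀ g ∈ stabilizer G z, ∀ x ∈ N, g * x * g⁻¹ ∈ N) ∧
      ∀ r, Γ.Adj z r → N ≤ stabilizer G r ∧ ∀ g ∈ stabilizer G r, ∀ x ∈ N, g * x * g⁻¹ ∈ N := by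
    intro z hz
    rw [SimpleGraph.reachable_iff_reflTransGen] at hz
    induction hz with
    | refl => exact ⟨⟨fun x hx => (hN hx).2, hv⟩, step u v huv (fun x hx => (hN hx).1) hu hv⟩
    | tail _ hb ih =>
      exact ⟨ih.2 _ hb, step _ _ hb ih.1.1 ih.1.2 (ih.2 _ hb).2⟩
  rw [eq_bot_iff]
  intro x hx
  exact h.faith x fun z => (key z (h.conn.preconnected v z)).1.1 hx

theorem mul_comm_Zsub (h : IsLocallyReflective Γ G) {u : α}
    (h1 : Zsub Γ G u ≤ ballStab Γ G u 1) {x y : G} (hx : x ∈ Zsub Γ G u)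
    (hy : y ∈ Zsub Γ G u) : Commute x y :=
  h.commute_Zsub (h1 hx) hy

theorem sq_Zsub (h : IsLocallyReflective Γ G) {u : α}
    (h1 : Zsub Γ G u ≤ ballStab Γ G u 1) {x : G} (hx : x ∈ Zsub Γ G u) : x ^ 2 = 1 := by
  induction hx using Subgroup.closure_induction with
  | mem x hx =>
    obtain ⟨k, hk, w, hw, y, hy, rfl⟩ := hx
    rw [conj_pow, (mem_Zuw.1 hy).2.2]
    simp
  | one => simp
  | mul a b ha' hb' ha hb => rw [(h.mul_comm_Zsub h1 ha' hb').mul_pow, ha, hb, one_mul]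
  | inv a _ ha => simp [ha]

theorem mem_Zuw_of_mem_Zsub (h : IsLocallyReflective Γ G) {u w : α}
    (h1 : Zsub Γ G u ≤ ballStab Γ G u 1) (hw : Γ.Adj u w) {x : G} (hx : x ∈ Zsub Γ G u)
    (hc : ∀ y ∈ arcStab G u w, Commute y x) : x ∈ Zuw G u w :=
  mem_Zuw.2 ⟨h.ballStab_one_le_arcStab hw (h1 hx), hc, h.sq_Zsub h1 hx⟩

theorem pow_two_pow_mem (h : IsLocallyReflective Γ G) (k : ℕ) : ∀ {u w : α} {g : G},
    Γ.Adj u w → g ∈ arcStab G u w → g ^ 2 ^ k ∈ ballStab Γ G u k := by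
  have sq : ∀ {u w : α} {g : G}, Γ.Adj u w → g ∈ arcStab G u w → g ^ 2 ∈ ballStab Γ G u 1 := by
    intro u w g hw hg
    by_cases hg' : g ∈ ballStab Γ G u 1
    · exact pow_mem hg' 2
    · rw [_root_.sq]
      exact h.reflection_mul_mem hw hg hg hg' hg'
  induction k with
  | zero =>
    intro u w g hw hg
    rw [mem_ballStab]
    intro z hz
    rw [Nat.le_zero, h.conn.dist_eq_zero_iff] at hz
    subst hz
    exact pow_mem hg.1 _
  | succ k ih =>
    intro u w g hw hg
    rw [mem_ballStab]
    intro z hz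
    have h1 := sq hw hg
    rw [pow_succ', pow_mul]
    obtain ⟨p, hp⟩ := h.conn.exists_walk_length_eq_dist u z
    cases p with
    | nil => exact pow_mem (h.ballStab_one_le_arcStab hw h1).1 _
    | cons hadj p =>
      have h3 := h.ballStab_one_le_arcStab hadj h1
      have h2 := ih hadj.symm ⟨h3.2, h3.1⟩
      refine mem_ballStab.1 h2 z ((SimpleGraph.dist_le p).trans ?_)
      rw [SimpleGraph.Walk.length_cons] at hp
      omega

/-- Arc stabilizers are 2-groups. -/
theorem isPGroup_arcStab (h : IsLocallyReflective Γ G) {u w : α} (hw : Γ.Adj u w) :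
    IsPGroup 2 (arcStab G u w) := by
  have hf := h.fin u
  have hf' : Finite (arcStab G u w) :=
    Finite.of_injective (Subgroup.inclusion inf_le_left) (Subgroup.inclusion_injective _)
  rintro ⟨g, hg⟩
  have ho : 0 < orderOf g := by
    have := orderOf_pos (⟨g, hg⟩ : arcStab G u w)
    rwa [Subgroup.orderOf_mk] at this
  obtain ⟨k, m, hm, e⟩ := Nat.exists_eq_two_pow_mul_odd ho.ne'
  refine ⟨k, Subtype.ext ?_⟩
  change g ^ 2 ^ k = 1
  have hg2 : (g ^ 2 ^ k) ^ m = 1 := by rw [← pow_mul, ← e, pow_orderOf_eq_one]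
  refine h.faith _ fun z => ?_
  have h1 := h.pow_two_pow_mem (m.totient * Γ.dist u z) hw (pow_mem hg (2 ^ k))
  have h2 : (2 ^ (m.totient * Γ.dist u z)) ≡ 1 [MOD m] := by
    have := (Nat.ModEq.pow_totient (Nat.coprime_two_left.2 hm)).pow (Γ.dist u z)
    rwa [one_pow, ← pow_mul] at this
  have h3 : (g ^ 2 ^ k) ^ 2 ^ (m.totient * Γ.dist u z) = g ^ 2 ^ k := by
    conv_rhs => rw [← pow_one (g ^ 2 ^ k)]
    exact pow_eq_pow_iff_modEq.2 (h2.of_dvd (orderOf_dvd_of_pow_eq_one hg2))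
  rw [h3] at h1
  refine mem_ballStab.1 h1 z (Nat.le_mul_of_pos_left _ (Nat.totient_pos.2 hm.pos))

theorem Zuw_ne_bot (h : IsLocallyReflective Γ G) {u w : α} (hw : Γ.Adj u w)
    (hne : arcStab G u w ≠ ⊥) : Zuw G u w ≠ ⊥ := by
  have hf := h.fin u
  have hf' : Finite (arcStab G u w) :=
    Finite.of_injective (Subgroup.inclusion inf_le_left) (Subgroup.inclusion_injective _)
  have hp := h.isPGroup_arcStab hw
  have : Fact (Nat.Prime 2) := ⟨Nat.prime_two⟩
  have hnt : Nontrivial (arcStab G u w) := (Subgroup.nontrivial_iff_ne_bot _).2 hne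
  have hc := hp.center_nontrivial
  have hd : 2 ∣ Nat.card (Subgroup.center (arcStab G u w)) :=
    ((hp.to_subgroup _).card_eq_or_dvd).resolve_left Finite.one_lt_card.ne'
  obtain ⟨x, hx⟩ := exists_prime_orderOf_dvd_card' 2 hd
  intro hbot
  have hx1 : ((x : arcStab G u w) : G) ∈ Zuw G u w := by
    refine mem_Zuw.2 ⟨x.1.2, fun y hy => ?_, ?_⟩
    · exact congrArg Subtype.val (Subgroup.mem_center_iff.1 x.2 ⟨y, hy⟩)
    · have := pow_orderOf_eq_one x
      rw [hx] at this
      exact congrArg (fun y : Subgroup.center (arcStab G u w) => ((y : arcStab G u w) : G)) this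
  rw [hbot, Subgroup.mem_bot] at hx1
  have : x = 1 := Subtype.ext (Subtype.ext hx1)
  rw [this, orderOf_one] at hx
  omega

end IsLocallyReflective

theorem Zsub_le {u : α} {K : Subgroup G} (hK : ∀ w, Γ.Adj u w → Zuw G u w ≤ K)
    (hadj : ∀ (g : G) (u w : α), Γ.Adj u w ↔ Γ.Adj (g • u) (g • w)) : Zsub Γ G u ≤ K := by
  refine (Subgroup.closure_le _).2 ?_
  rintro _ ⟨k, hk, w, hw, g, hg, rfl⟩
  have h1 := conj_mem_Zuw k hg
  have h2 := (hadj k u w).1 hw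
  rw [mem_stabilizer_iff.1 hk] at h1 h2
  exact hK _ h2 h1

theorem commutator_mul_cancel (t z : G) : ⁅t, z⁆ * z = t * z * t⁻¹ := by
  rw [commutatorElement_def, inv_mul_cancel_right]

theorem commutator_ne_one_comm {t z : G} : ⁅t, z⁆ ≠ 1 ↔ ⁅z, t⁆ ≠ 1 := by
  rw [← commutatorElement_inv, inv_ne_one]

theorem commutator_eq_of_commute {s t z : G} (h : Commute (t⁻¹ * s) z) : ⁅s, z⁆ = ⁅t, z⁆ := by
  obtain ⟨q, rfl⟩ : ∃ q, s = t * q := ⟨t⁻¹ * s, by simp⟩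
  rw [inv_mul_cancel_left] at h
  rw [commutatorElement_def, commutatorElement_def, mul_assoc t q z, h.eq]
  group

theorem le_centralizer_singleton {K : Subgroup G} {z : G} :
    K ≤ Subgroup.centralizer {z} ↔ ∀ g ∈ K, Commute g z :=
  forall₂_congr fun _ _ => Subgroup.mem_centralizer_singleton_iff

namespace IsLocallyReflective

theorem ballStab_le (h : IsLocallyReflective Γ G) {u v : α} {s r : ℕ}
    (hs : r + Γ.dist u v ≤ s) : ballStab Γ G u s ≤ ballStab Γ G v r := fun g hg => by
  rw [mem_ballStab] at *
  intro w hw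
  have := h.conn.dist_triangle (u := u) (v := v) (w := w)
  exact hg w (by omega)

/-- If a symmetric equivariant family of subgroups of the arc stabilizers is normalized at one arc
by the stabilizer of the first vertex, then its member at that arc is trivial. -/
theorem eq_bot_of_symm (h : IsLocallyReflective Γ G) {N : α → α → Subgroup G}
    (hsymm : ∀ u w, N u w = N w u)
    (hconj : ∀ (g : G) {u w x}, x ∈ N u w → g * x * g⁻¹ ∈ N (g • u) (g • w)) {u w : α}
    (hw : Γ.Adj u w) (hN : N u w ≤ arcStab G u w)
    (hu : ∀ g ∈ stabilizer G u, ∀ x ∈ N u w, g * x * g⁻¹ ∈ N u w) : N u w = ⊥ := by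
  refine h.eq_bot_of_normalized hw hN hu fun g hg x hx => ?_
  obtain ⟨k, hku, hkw⟩ := h.arc u w w u hw hw.symm
  have h1 := conj_mem_stabilizer k⁻¹ hg
  rw [inv_smul_eq_iff.2 hku.symm] at h1
  have h2 := hconj k⁻¹ hx
  rw [inv_smul_eq_iff.2 hku.symm, inv_smul_eq_iff.2 hkw.symm, hsymm] at h2
  have h3 := hconj k (hu _ h1 _ h2)
  rw [hku, hkw, hsymm] at h3
  simpa [mul_assoc] using h3

theorem Zuw_eq_bot (h : IsLocallyReflective Γ G) {u w : α} (hw : Γ.Adj u w)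
    (hc : ∀ x ∈ Zuw G u w, ∀ g ∈ stabilizer G u, Commute g x) : Zuw G u w = ⊥ := by
  refine h.eq_bot_of_symm (N := Zuw G) Zuw_comm (fun g _ _ _ => conj_mem_Zuw g) hw
    (fun x hx => (mem_Zuw.1 hx).1)
    fun g hg x hx => ?_
  rwa [(hc x hx g hg).eq, mul_inv_cancel_right]

/-- A vertex stabilizer is generated by `G_u^{[1]}` and one reflection at each neighbour. -/
theorem commute_of_reflections (h : IsLocallyReflective Γ G) {u : α} {z : G}
    (hQ : ∀ q ∈ ballStab Γ G u 1, Commute q z)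
    (hr : ∀ m, Γ.Adj u m → ∃ t ∈ arcStab G u m, t ∉ ballStab Γ G u 1 ∧ Commute t z) :
    ∀ g ∈ stabilizer G u, Commute g z := by
  rw [← le_centralizer_singleton] at *
  refine h.stabilizer_le_of_forall fun w hw => ?_
  obtain ⟨t, ht, ht', htz⟩ := hr w hw
  exact h.arcStab_le hw ht ht' hQ (Subgroup.mem_centralizer_singleton_iff.2 htz)

theorem commute_arcStab (h : IsLocallyReflective Γ G) {u w : α} {t z : G} (hw : Γ.Adj u w)
    (hz : z ∈ Zsub Γ G u) (ht : t ∈ arcStab G u w) (ht' : t ∉ ballStab Γ G u 1)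
    (htz : Commute t z) : ∀ g ∈ arcStab G u w, Commute g z :=
  le_centralizer_singleton.1 <| h.arcStab_le hw ht ht'
    (le_centralizer_singleton.2 fun _ hq => h.commute_Zsub hq hz)
    (Subgroup.mem_centralizer_singleton_iff.2 htz)

end IsLocallyReflective

/-- A walk `p 0, …, p (k + 3)` joining a critical pair. -/
structure IsCriticalPath (Γ : SimpleGraph α) (G : Type*) [Group G] [MulAction G α] (k : ℕ)
    (p : ℕ → α) : Prop where
  adj : ∀ i < k + 3, Γ.Adj (p i) (p (i + 1))
  not_le : ¬ Zsub Γ G (p 0) ≤ ballStab Γ G (p (k + 3)) 1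

/-- The critical distance of `(Γ, G)` is `k + 3`, and the groups `Z_{uw}` are non-trivial. -/
structure HasCriticalDist (Γ : SimpleGraph α) (G : Type*) [Group G] [MulAction G α] (k : ℕ) : Prop
    extends IsLocallyReflective Γ G where
  Zuw_ne : ∀ {u w : α}, Γ.Adj u w → Zuw G u w ≠ ⊥
  le_of_dist : ∀ {u v : α}, Γ.dist u v < k + 3 → Zsub Γ G u ≤ ballStab Γ G v 1
  exists_path : ∃ p, IsCriticalPath Γ G k p

namespace HasCriticalDist

variable {k : ℕ} {p : ℕ → α}

theorem Zsub_le_self (c : HasCriticalDist Γ G k) (u : α) : Zsub Γ G u ≤ ballStab Γ G u 1 :=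
  c.le_of_dist (by simp)

theorem Zsub_le_arcStab (c : HasCriticalDist Γ G k) {u w : α} (hw : Γ.Adj u w) :
    Zsub Γ G u ≤ arcStab G u w :=
  (c.Zsub_le_self u).trans (c.ballStab_one_le_arcStab hw)

theorem dist_le (c : HasCriticalDist Γ G k) (hp : IsCriticalPath Γ G k p) {i j : ℕ} (hij : i ≤ j)
    (hj : j ≤ k + 3) : Γ.dist (p i) (p j) ≤ j - i := by
  induction j, hij using Nat.le_induction with
  | base => simp
  | succ j hij ih =>
    have h1 := ih (by omega)
    have h2 := c.conn.dist_triangle (u := p i) (v := p j) (w := p (j + 1))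
    have h3 := SimpleGraph.dist_eq_one_iff_adj.2 (hp.adj j (by omega))
    omega

theorem le_of_path (c : HasCriticalDist Γ G k) (hp : IsCriticalPath Γ G k p) {i j : ℕ}
    (hi : i ≤ k + 3) (hj : j ≤ k + 3) (h1 : i < j + (k + 3)) (h2 : j < i + (k + 3)) :
    Zsub Γ G (p i) ≤ ballStab Γ G (p j) 1 := by
  refine c.le_of_dist ?_
  rcases le_total i j with h | h
  · have := c.dist_le hp h hj
    omega
  · have := c.dist_le hp h hi
    rw [SimpleGraph.dist_comm]
    omega

/-- An element outside `G_v^{[1]}` of an arc stabilizer at `v` does not centralize `Z_v`. -/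
theorem exists_commutator_ne_one (c : HasCriticalDist Γ G k) {v y : α} {t : G} (hy : Γ.Adj v y)
    (ht : t ∈ arcStab G v y) (ht' : t ∉ ballStab Γ G v 1) : ∃ z ∈ Zsub Γ G v, ⁅t, z⁆ ≠ 1 := by
  by_contra! hcon
  refine c.Zuw_ne hy (c.Zuw_eq_bot hy fun x hx => ?_)
  refine c.commute_of_reflections (fun q hq => c.commute_Zsub hq (Zuw_le_Zsub hy hx)) fun m hm => ?_
  obtain ⟨g, hg, rfl⟩ := c.exists_stabilizer_smul_eq hy hm
  have h1 := conj_mem_arcStab g ht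
  have h2 := c.notMem_conj_ballStab g ht'
  rw [mem_stabilizer_iff.1 hg] at h1 h2
  refine ⟨_, h1, h2, ?_⟩
  have h3 := commutatorElement_eq_one_iff_commute.1
    (hcon _ (c.conj_mem_Zsub_self (inv_mem hg) (Zuw_le_Zsub hy hx)))
  simpa [mul_assoc] using h3.map (MulAut.conj g)

theorem exists_mem_Zsub_notMem (c : HasCriticalDist Γ G k) (hp : IsCriticalPath Γ G k p) :
    ∃ t ∈ Zsub Γ G (p 0), t ∈ arcStab G (p (k + 3)) (p (k + 2)) ∧
      t ∉ ballStab Γ G (p (k + 3)) 1 := by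
  obtain ⟨t, ht, ht'⟩ := Set.not_subset.1 hp.not_le
  have h1 := c.le_of_path hp (i := 0) (j := k + 2) (by omega) (by omega) (by omega) (by omega) ht
  have h2 := c.ballStab_one_le_arcStab (hp.adj (k + 2) (by omega)) h1
  exact ⟨t, ht, ⟨h2.2, h2.1⟩, ht'⟩

theorem commutator_eq_of_path (c : HasCriticalDist Γ G k) (hp : IsCriticalPath Γ G k p)
    {s s' z z' : G} (hs : s ∈ arcStab G (p (k + 3)) (p (k + 2)))
    (hs' : s' ∈ arcStab G (p (k + 3)) (p (k + 2))) (hz : z ∈ Zsub Γ G (p (k + 3)))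
    (hz' : z' ∈ Zsub Γ G (p (k + 3))) (h1 : ⁅s, z⁆ ≠ 1) (h2 : ⁅s', z'⁆ ≠ 1) :
    ⁅s, z⁆ = ⁅s', z'⁆ := by
  obtain ⟨t, htZ, ht, ht'⟩ := c.exists_mem_Zsub_notMem hp
  have hvy := (hp.adj (k + 2) (by omega)).symm
  have hux := hp.adj 0 (by omega)
  have main : ∀ {s z}, s ∈ arcStab G (p (k + 3)) (p (k + 2)) → z ∈ Zsub Γ G (p (k + 3)) →
      ⁅s, z⁆ ≠ 1 → ⁅s, z⁆ = ⁅t, z⁆ := by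
    intro s z hs hz h1
    refine commutator_eq_of_commute (c.commute_Zsub (c.inv_mul_mem hvy ht hs ht' fun hsQ => ?_) hz)
    exact h1 (commutatorElement_eq_one_iff_commute.2 (c.commute_Zsub hsQ hz))
  have hx : ∀ {z}, z ∈ Zsub Γ G (p (k + 3)) → z ∈ arcStab G (p 0) (p 1) := fun hz =>
    arcStab_comm (G := G) (p 1) (p 0) ▸ c.ballStab_one_le_arcStab hux.symm
      (c.le_of_path hp (by omega) (by omega) (by omega) (by omega) hz)
  have hQ : ∀ {z}, ⁅t, z⁆ ≠ 1 → z ∉ ballStab Γ G (p 0) 1 := fun hz hzQ =>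
    hz (commutatorElement_eq_one_iff_commute.2 (c.commute_Zsub hzQ htZ).symm)
  have e1 := main hs hz h1
  have e2 := main hs' hz' h2
  rw [e1] at h1 ⊢
  rw [e2] at h2 ⊢
  have hc := c.commute_Zsub (c.reflection_mul_mem hux (hx hz) (hx hz') (hQ h1) (hQ h2)) htZ
  have hC := c.commutator_mem_Zsub ht.1 hz
  have hD := c.commutator_mem_Zsub ht.1 hz'
  have hl := c.Zsub_le_self (p (k + 3))
  have e : ⁅t, z⁆ * ⁅t, z'⁆ = 1 := by
    have : ⁅t, z⁆ * ⁅t, z'⁆ * (z * z') = z * z' := by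
      calc _ = ⁅t, z⁆ * (⁅t, z'⁆ * z) * z' := by group
        _ = (⁅t, z⁆ * z) * (⁅t, z'⁆ * z') := by rw [(c.mul_comm_Zsub hl hD hz).eq]; group
        _ = t * (z * z') * t⁻¹ := by simp only [commutator_mul_cancel]; group
        _ = z * z' := by rw [← hc.eq, mul_inv_cancel_right]
    exact mul_eq_right.1 this
  have hsq := c.sq_Zsub hl hD
  rw [sq] at hsq
  exact mul_right_cancel (e.trans hsq.symm)

/-- The subgroup `[G_{vy}, Z_v]` has at most one non-trivial element. -/
theorem commutator_eq (c : HasCriticalDist Γ G k) {v y : α} {s s' z z' : G} (hy : Γ.Adj v y)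
    (hs : s ∈ arcStab G v y) (hs' : s' ∈ arcStab G v y) (hz : z ∈ Zsub Γ G v)
    (hz' : z' ∈ Zsub Γ G v) (h1 : ⁅s, z⁆ ≠ 1) (h2 : ⁅s', z'⁆ ≠ 1) : ⁅s, z⁆ = ⁅s', z'⁆ := by
  obtain ⟨p, hp⟩ := c.exists_path
  obtain ⟨g, hv, hy⟩ := c.arc _ _ _ _ hy (hp.adj (k + 2) (by omega)).symm
  have a1 := conj_mem_arcStab g hs
  have a2 := conj_mem_arcStab g hs'
  have a3 := c.conj_mem_Zsub g hz
  have a4 := c.conj_mem_Zsub g hz'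
  rw [hv, hy] at a1 a2
  rw [hv] at a3 a4
  have := c.commutator_eq_of_path hp a1 a2 a3 a4
  rw [← conjugate_commutatorElement, ← conjugate_commutatorElement] at this
  simpa [h1, h2] using this

theorem commutator_mem_Zuw (c : HasCriticalDist Γ G k) {v y : α} {s z : G} (hy : Γ.Adj v y)
    (hs : s ∈ arcStab G v y) (hz : z ∈ Zsub Γ G v) : ⁅s, z⁆ ∈ Zuw G v y := by
  refine c.mem_Zuw_of_mem_Zsub (c.Zsub_le_self v) hy (c.commutator_mem_Zsub hs.1 hz)
    fun g hg => ?_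
  by_cases h1 : ⁅s, z⁆ = 1
  · rw [h1]; exact Commute.one_right g
  have h2 : g * ⁅s, z⁆ * g⁻¹ ≠ 1 := by simpa using h1
  rw [conjugate_commutatorElement] at h2
  have h3 := c.commutator_eq hy hs (mul_mem (mul_mem hg hs) (inv_mem hg)) hz
    (c.conj_mem_Zsub_self hg.1 hz) h1 h2
  rw [← conjugate_commutatorElement] at h3
  exact (eq_mul_inv_iff_mul_eq.1 h3).symm

/-- A product `a` of two reflections that does not centralize `Z_u` has the same centralizer in
`Z_u` as the whole vertex stabilizer. -/
theorem commute_of_commute_mul (c : HasCriticalDist Γ G k) {u w x y : α} {s t τ z z' : G}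
    (hw : Γ.Adj u w) (hx : Γ.Adj u x) (hy : Γ.Adj u y) (hs : s ∈ arcStab G u w)
    (ht : t ∈ arcStab G u x) (hτ : τ ∈ arcStab G u y) (hs' : s ∉ ballStab Γ G u 1)
    (ht' : t ∉ ballStab Γ G u 1) (hτ' : τ ∉ ballStab Γ G u 1) (hz' : z' ∈ Zsub Γ G u)
    (hne : ¬ Commute (s * t) z') (hz : z ∈ Zsub Γ G u) (hc : Commute (s * t) z) :
    Commute τ z := by
  by_contra hτz
  have hr1 : ⁅τ, z⁆ ≠ 1 := mt commutatorElement_eq_one_iff_commute.1 hτz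
  have hq := c.conj_mul_mem hw hx hy hs ht hτ hs' ht' hτ'
  have h3 := c.cube_mem hw hx hs ht hs' ht'
  have ha : s * t ∈ stabilizer G u := mul_mem hs.1 ht.1
  generalize s * t = a at *
  have hl := c.Zsub_le_self u
  have conj : ∀ {x}, x ∈ Zsub Γ G u → τ * (a * x * a⁻¹) * τ⁻¹ = a⁻¹ * (τ * x * τ⁻¹) * a := by
    intro x hx
    have h1 : a⁻¹ * (τ * x * τ⁻¹) * a⁻¹⁻¹ ∈ Zsub Γ G u :=
      c.conj_mem_Zsub_self (inv_mem ha) (c.conj_mem_Zsub_self hτ.1 hx)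
    rw [inv_inv] at h1
    have h2 := (c.commute_Zsub hq h1).eq
    rw [← mul_inv_eq_iff_eq_mul] at h2
    rw [← h2]
    group
  have har : Commute a ⁅τ, z⁆ := by
    have h1 := conj hz
    rw [hc.eq, mul_inv_cancel_right, ← commutator_mul_cancel, mul_assoc a⁻¹, mul_assoc ⁅τ, z⁆,
      ← hc.eq, ← mul_assoc ⁅τ, z⁆, ← mul_assoc] at h1
    have h2 := mul_right_cancel h1
    rw [eq_inv_mul_iff_mul_eq] at h2
    exact h2
  have hcomm : ∀ {x}, x ∈ Zsub Γ G u → Commute a ⁅τ, x⁆ := fun {x} hx => by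
    by_cases h1 : ⁅τ, x⁆ = 1
    · rw [h1]; exact Commute.one_right a
    · rwa [c.commutator_eq hy hτ hτ hx hz h1 hr1]
  have hz'' := c.conj_mem_Zsub_self ha hz'
  have he := c.commutator_mem_Zsub hτ.1 hz'
  have he' := c.commutator_mem_Zsub hτ.1 hz''
  have hae := hcomm hz'
  have hae' := hcomm hz''
  have h1 := conj hz'
  rw [← commutator_mul_cancel τ, ← commutator_mul_cancel τ] at h1
  generalize ⁅τ, z'⁆ = e at *
  generalize ⁅τ, a * z' * a⁻¹⁆ = e' at *
  have hε : Commute a (e'⁻¹ * e) := hae'.inv_right.mul_right hae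
  have key : a ^ 2 * z' * (a ^ 2)⁻¹ = e'⁻¹ * e * z' := by
    calc _ = e'⁻¹ * (e' * a) * (a * z' * a⁻¹) * a⁻¹ := by simp only [pow_two]; group
      _ = e'⁻¹ * (a * (e' * (a * z' * a⁻¹)) * a⁻¹) := by rw [← hae'.eq]; group
      _ = _ := by rw [h1]; group
  have hε2 := c.sq_Zsub hl (mul_mem (inv_mem he') he)
  generalize e'⁻¹ * e = ε at *
  have h4 : a ^ 4 * z' * (a ^ 4)⁻¹ = z' := by
    calc _ = a ^ 2 * (a ^ 2 * z' * (a ^ 2)⁻¹) * (a ^ 2)⁻¹ := by group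
      _ = a ^ 2 * ε * z' * (a ^ 2)⁻¹ := by rw [key]; group
      _ = ε * (a ^ 2 * z' * (a ^ 2)⁻¹) := by rw [(hε.pow_left 2).eq]; group
      _ = ε ^ 2 * z' := by rw [key, pow_two ε, mul_assoc]
      _ = z' := by rw [hε2, one_mul]
  have h5 : Commute (a ^ 4) z' := mul_inv_eq_iff_eq_mul.1 h4
  have h6 := h5.mul_left (c.commute_Zsub h3 hz').inv_left
  rw [pow_succ' a 3, mul_inv_cancel_right] at h6
  exact hne h6

/-- An element of `Z_{uw}` commuting with a reflection of `G_{ux}` is central in `G_u`, provided that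
`Z_{uw}` is not contained in `Z_{ux}`. -/
theorem commute_stabilizer (c : HasCriticalDist Γ G k) {u w x : α} {t z : G} (hw : Γ.Adj u w)
    (hx : Γ.Adj u x) (ht : t ∈ arcStab G u x) (ht' : t ∉ ballStab Γ G u 1)
    (hne : ¬ Zuw G u w ≤ Zuw G u x) (hz : z ∈ Zuw G u w) (hzt : Commute t z) :
    ∀ g ∈ stabilizer G u, Commute g z := by
  obtain ⟨z', hz', hz''⟩ := Set.not_subset.1 hne
  obtain ⟨s, hs, hs'⟩ := c.exists_reflection hw
  have hZ := Zuw_le_Zsub hw hz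
  refine c.commute_of_reflections (fun q hq => c.commute_Zsub hq hZ) fun y hy => ?_
  obtain ⟨τ, hτ, hτ'⟩ := c.exists_reflection hy
  refine ⟨τ, hτ, hτ', c.commute_of_commute_mul hw hx hy hs ht hτ hs' ht' hτ' (Zuw_le_Zsub hw hz')
    (fun hc => hz'' ?_) hZ (((mem_Zuw.1 hz).2.1 s hs).mul_left hzt)⟩
  have h1 := ((mem_Zuw.1 hz').2.1 s hs).inv_left.mul_left hc
  rw [inv_mul_cancel_left] at h1
  exact c.mem_Zuw_of_mem_Zsub (c.Zsub_le_self u) hx (Zuw_le_Zsub hw hz')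
    (c.commute_arcStab hx (Zuw_le_Zsub hw hz') ht ht' h1)

/-- An element of `Z_{p 0}` outside `G_{p (k + 3)}^{[1]}` conjugates `Z_w` into
`⟨Z_{p (k + 3)}, Z_w⟩`. -/
theorem conj_mem_sup (c : HasCriticalDist Γ G k) (hp : IsCriticalPath Γ G k p) {w : α}
    {t x : G} (ht : t ∈ Zsub Γ G (p 0)) (htv : t ∈ arcStab G (p (k + 3)) (p (k + 2)))
    (ht' : t ∉ ballStab Γ G (p (k + 3)) 1) (hw : Zsub Γ G w ≤ ballStab Γ G (p 1) 1)
    (hx : x ∈ Zsub Γ G w) : t * x * t⁻¹ ∈ Zsub Γ G (p (k + 3)) ⊔ Zsub Γ G w := by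
  have hvy := (hp.adj (k + 2) (by omega)).symm
  have hux := hp.adj 0 (by omega)
  have hQ : ballStab Γ G (p 1) 1 ≤ arcStab G (p 0) (p 1) :=
    arcStab_comm (G := G) (p 1) (p 0) ▸ c.ballStab_one_le_arcStab hux.symm
  obtain ⟨g, hg, hg1⟩ := c.exists_commutator_ne_one hvy htv ht'
  have hgx : g ∈ arcStab G (p 0) (p 1) :=
    hQ (c.le_of_path hp (by omega) (by omega) (by omega) (by omega) hg)
  rw [← commutator_mul_cancel]
  refine mul_mem (Subgroup.mem_sup_left ?_) (Subgroup.mem_sup_right hx)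
  by_cases h1 : ⁅t, x⁆ = 1
  · rw [h1]; exact one_mem _
  · have := c.commutator_eq hux (hQ (hw hx)) hgx ht ht (commutator_ne_one_comm.1 h1)
      (commutator_ne_one_comm.1 hg1)
    rw [← commutatorElement_inv, ← commutatorElement_inv t g, inv_inj] at this
    rw [this]
    exact c.commutator_mem_Zsub htv.1 hg

theorem conj_mem_sup_Zsub (c : HasCriticalDist Γ G k) (g : G) {u w : α} {x : G}
    (hx : x ∈ Zsub Γ G u ⊔ Zsub Γ G w) :
    g * x * g⁻¹ ∈ Zsub Γ G (g • u) ⊔ Zsub Γ G (g • w) := by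
  have h1 : Zsub Γ G u ⊔ Zsub Γ G w ≤
      (Zsub Γ G (g • u) ⊔ Zsub Γ G (g • w)).comap (MulAut.conj g).toMonoidHom :=
    sup_le (fun y hy => Subgroup.mem_sup_left (c.conj_mem_Zsub g hy))
      (fun y hy => Subgroup.mem_sup_right (c.conj_mem_Zsub g hy))
  exact h1 hx

/-- A critical path extends by a neighbour `w` of its end vertex `v` such that `Z_w` does not fix the
neighbourhood of `p 1` pointwise and `Z_{vw}` is not contained in `Z_{vy}`, `y` the vertex before
`v`. -/
theorem exists_not_le (c : HasCriticalDist Γ G k) (hp : IsCriticalPath Γ G k p) :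
    ∃ w, Γ.Adj (p (k + 3)) w ∧ ¬ Zsub Γ G w ≤ ballStab Γ G (p 1) 1 ∧
      ¬ Zuw G (p (k + 3)) w ≤ Zuw G (p (k + 3)) (p (k + 2)) := by
  by_contra! hcon
  obtain ⟨t, htZ, ht, ht'⟩ := c.exists_mem_Zsub_notMem hp
  have hvy := (hp.adj (k + 2) (by omega)).symm
  have hgood : ∀ w, Γ.Adj (p (k + 3)) w →
      ¬ Zuw G (p (k + 3)) w ≤ Zuw G (p (k + 3)) (p (k + 2)) →
      Zsub Γ G w ≤ ballStab Γ G (p 1) 1 := fun w hw hw' => by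
    by_contra h1
    exact hw' (hcon w hw h1)
  clear hcon
  have hconj := fun {w x} => c.conj_mem_sup hp (w := w) (x := x) htZ ht ht'
  clear htZ
  generalize p (k + 3) = v at *
  generalize p (k + 2) = y at *
  have step : ∀ a b, Γ.Adj v a → Γ.Adj v b → Zuw G v a ≠ Zuw G v b →
      Zsub Γ G v ⊔ Zsub Γ G b ≤ Zsub Γ G v ⊔ Zsub Γ G a := by
    intro a b ha hb hab
    obtain ⟨m, hm, hm'⟩ := c.exists_midpoint ha hb fun e => hab (by rw [e])
    obtain ⟨g, hg, rfl⟩ := c.exists_stabilizer_smul_eq hm hvy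
    have hgi : g⁻¹ • v = v := inv_smul_eq_iff.2 (mem_stabilizer_iff.1 hg).symm
    have h1 := conj_mem_arcStab g⁻¹ ht
    have h2 := c.notMem_conj_ballStab g⁻¹ ht'
    rw [inv_smul_smul, hgi] at h1
    rw [hgi] at h2
    have hga : Γ.Adj v (g • a) := by
      have := c.adj_smul g ha
      rwa [mem_stabilizer_iff.1 hg] at this
    have htb : t • g • a = g • b := by
      have := hm' _ h1 h2
      rwa [inv_inv, mul_smul, mul_smul, inv_smul_eq_iff] at this
    have key := hgood (g • a) hga fun hle => hab ?_
    · refine sup_le le_sup_left fun x hx => ?_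
      have h3 := c.conj_mem_Zsub t⁻¹ (c.conj_mem_Zsub g hx)
      rw [← htb, inv_smul_smul] at h3
      have h4 := c.conj_mem_sup_Zsub g⁻¹ (hconj key h3)
      rw [hgi, inv_smul_smul] at h4
      simpa [mul_assoc] using h4
    · have ht2 : ∀ x, x ∈ Zuw G v (g • a) ↔ x ∈ Zuw G v (g • b) := fun x => by
        have hcomm := fun {x} hx => (mem_Zuw.1 (hle (x := x) hx)).2.1 t ht
        have hiff := fun {x} => conj_mem_Zuw_iff (u := v) (w := g • a) (x := x) t
        rw [htb, mem_stabilizer_iff.1 ht.1] at hiff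
        constructor
        · intro hx
          have := hiff.2 hx
          rwa [(hcomm hx).eq, mul_inv_cancel_right] at this
        · intro hx
          have h3 : t⁻¹ * x * t ∈ Zuw G v (g • a) := hiff.1 (by simpa [mul_assoc] using hx)
          have h4 := hcomm h3
          rw [mul_assoc, commute_iff_eq, mul_inv_cancel_left, mul_assoc, eq_inv_mul_iff_mul_eq,
            ← mul_assoc t, mul_left_inj] at h4
          rwa [mul_assoc, ← h4, inv_mul_cancel_left] at h3
      ext x
      rw [← conj_mem_Zuw_iff g, ← conj_mem_Zuw_iff (w := b) g, mem_stabilizer_iff.1 hg, ht2]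
  have hex : ∃ a b, Γ.Adj v a ∧ Γ.Adj v b ∧ Zuw G v a ≠ Zuw G v b := by
    by_contra! hall
    refine c.Zuw_ne hvy (c.Zuw_eq_bot hvy fun x hx => ?_)
    refine c.commute_of_reflections (fun q hq => c.commute_Zsub hq (Zuw_le_Zsub hvy hx))
      fun m hm => ?_
    obtain ⟨τ, hτ, hτ'⟩ := c.exists_reflection hm
    rw [hall y m hvy hm] at hx
    exact ⟨τ, hτ, hτ', (mem_Zuw.1 hx).2.1 τ hτ⟩
  obtain ⟨a, b, ha, hb, hab⟩ := hex
  have hle : ∀ d, Γ.Adj v d → Zsub Γ G v ⊔ Zsub Γ G d ≤ Zsub Γ G v ⊔ Zsub Γ G a := by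
    intro d hd
    by_cases h1 : Zuw G v a = Zuw G v d
    · exact (step b d hb hd (by rw [← h1]; exact hab.symm)).trans (step a b ha hb hab)
    · exact step a d ha hd h1
  have hbot := c.eq_bot_of_symm (N := fun u w => Zsub Γ G u ⊔ Zsub Γ G w)
    (fun u w => sup_comm _ _) (fun g _ _ _ hx => c.conj_mem_sup_Zsub g hx) ha
    (sup_le (c.Zsub_le_arcStab ha) (arcStab_comm (G := G) a v ▸ c.Zsub_le_arcStab ha.symm))
    fun g hg x hx => by
      have h1 := c.conj_mem_sup_Zsub g hx
      have h2 := c.adj_smul g ha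
      rw [mem_stabilizer_iff.1 hg] at h1 h2
      exact hle _ h2 h1
  exact c.Zuw_ne ha (eq_bot_iff.2 (((Zuw_le_Zsub ha).trans le_sup_left).trans hbot.le))

theorem commutator_mem_of_notMem (c : HasCriticalDist Γ G k) {v w x y : α} {s z z' : G}
    (hw : Γ.Adj v w) (hx : Γ.Adj x y) (hz : z ∈ Zsub Γ G w) (hzx : z ∈ arcStab G x y)
    (hz' : z ∉ ballStab Γ G x 1) (hxv : Zsub Γ G x ≤ ballStab Γ G v 1)
    (hs : s ∈ arcStab G w v) (hsz : z' ∈ Zsub Γ G w) : ⁅s, z'⁆ ∈ Zsub Γ G x := by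
  obtain ⟨g, hg, hg1⟩ := c.exists_commutator_ne_one hx hzx hz'
  by_cases h1 : ⁅s, z'⁆ = 1
  · rw [h1]; exact one_mem _
  have hgs : g ∈ arcStab G w v :=
    arcStab_comm (G := G) v w ▸ c.ballStab_one_le_arcStab hw (hxv hg)
  rw [c.commutator_eq hw.symm hs hgs hsz hz h1 (commutator_ne_one_comm.1 hg1),
    ← commutatorElement_inv]
  exact inv_mem (c.commutator_mem_Zsub hzx.1 hg)

theorem dist_le_add_one (c : HasCriticalDist Γ G k) (hp : IsCriticalPath Γ G k p) {w : α} {i : ℕ}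
    (hw : Γ.Adj (p (k + 3)) w) (hi : i ≤ k + 3) : Γ.dist (p i) w ≤ k + 4 - i := by
  have h1 := c.dist_le hp hi le_rfl
  have h2 := c.conn.dist_triangle (u := p i) (v := p (k + 3)) (w := w)
  have h3 := SimpleGraph.dist_eq_one_iff_adj.2 hw
  omega

/-- The subgroup `[G_{wv}, Z_w]` is central in `G_v`. -/
theorem commute_commutator (c : HasCriticalDist Γ G k) {v w : α} {s z g : G} (hw : Γ.Adj v w)
    (hs : s ∈ arcStab G w v) (hz : z ∈ Zsub Γ G w) (hg : g ∈ stabilizer G v) :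
    Commute g ⁅s, z⁆ := by
  obtain ⟨p, hp⟩ := c.exists_path
  obtain ⟨w', hw', hnot, hne⟩ := c.exists_not_le hp
  obtain ⟨t, htZ, ht, ht'⟩ := c.exists_mem_Zsub_notMem hp
  obtain ⟨f, hf1, hf2⟩ := c.arc _ _ _ _ hw hw'
  have a1 := conj_mem_arcStab f hs
  have a2 := c.conj_mem_Zsub f hz
  have a3 := conj_mem_stabilizer f hg
  rw [hf1, hf2] at a1
  rw [hf2] at a2
  rw [hf1] at a3
  obtain ⟨ζ, hζ, hζ'⟩ := Set.not_subset.1 hnot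
  have hx := hp.adj 1 (by omega)
  have hζ2 : ζ ∈ ballStab Γ G (p 2) 1 := c.le_of_dist (by
    rw [SimpleGraph.dist_comm]
    have := c.dist_le_add_one hp hw' (i := 2) (by omega)
    omega) hζ
  have hζx := c.ballStab_one_le_arcStab hx.symm hζ2
  rw [arcStab_comm] at hζx
  have h1 := c.commutator_mem_of_notMem hw' hx hζ hζx hζ'
    (c.le_of_path hp (by omega) (by omega) (by omega) (by omega)) a1 a2
  have h2 := c.commutator_mem_Zuw hw'.symm a1 a2
  rw [Zuw_comm] at h2
  have h3 := c.commute_Zsub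
    (c.le_of_path hp (by omega) (by omega) (by omega) (by omega) htZ) h1
  have h4 := c.commute_stabilizer hw' (hp.adj (k + 2) (by omega)).symm ht ht' hne h2 h3 _ a3
  rw [← conjugate_commutatorElement] at h4
  simpa [mul_assoc] using h4.map (MulAut.conj f⁻¹)

theorem isCriticalPath_shift (c : HasCriticalDist Γ G k) (hp : IsCriticalPath Γ G k p) {w : α}
    (hw : Γ.Adj (p (k + 3)) w) (hnot : ¬ Zsub Γ G w ≤ ballStab Γ G (p 1) 1) :
    IsCriticalPath Γ G k fun i => if i ≤ k + 2 then p (i + 1) else w := by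
  refine ⟨fun i hi => ?_, ?_⟩
  · rcases Nat.lt_or_ge i (k + 2) with h1 | h1
    · simpa [show i ≤ k + 2 by omega, show i + 1 ≤ k + 2 by omega] using hp.adj (i + 1) (by omega)
    · obtain rfl : i = k + 2 := by omega
      simpa using hw
  · intro hle
    simp only [Nat.zero_le, if_true, zero_add, show ¬ k + 3 ≤ k + 2 by omega, if_false] at hle
    obtain ⟨ζ, hζ, hζ'⟩ := Set.not_subset.1 hnot
    have hx := hp.adj 1 (by omega)
    have hζ2 : ζ ∈ ballStab Γ G (p 2) 1 := c.le_of_dist (by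
      rw [SimpleGraph.dist_comm]
      have := c.dist_le_add_one hp hw (i := 2) (by omega)
      omega) hζ
    have hζx := c.ballStab_one_le_arcStab hx.symm hζ2
    rw [arcStab_comm] at hζx
    obtain ⟨g, hg, hg1⟩ := c.exists_commutator_ne_one hx hζx hζ'
    exact hg1 (commutatorElement_eq_one_iff_commute.2 (c.commute_Zsub (hle hg) hζ).symm)

theorem elim_false (c : HasCriticalDist Γ G k) : False := by
  obtain ⟨p, hp⟩ := c.exists_path
  obtain ⟨t, htZ, ht, ht'⟩ := c.exists_mem_Zsub_notMem hp
  obtain ⟨w, hw, hnot, hne⟩ := c.exists_not_le hp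
  have hvy := (hp.adj (k + 2) (by omega)).symm
  obtain ⟨q, hq, hqnot, -⟩ := c.exists_not_le (c.isCriticalPath_shift hp hw hnot)
  simp only [show ¬ k + 3 ≤ k + 2 by omega, if_false, show 1 ≤ k + 2 by omega, if_true,
    one_add_one_eq_two] at hq hqnot
  obtain ⟨ζ, hζ, hζ'⟩ := Set.not_subset.1 hqnot
  have hx := hp.adj 2 (by omega)
  have hζ2 : ζ ∈ ballStab Γ G (p 3) 1 := c.le_of_dist (by
    rw [SimpleGraph.dist_comm]
    have h1 := c.dist_le_add_one hp hw (i := 3) (by omega)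
    have h2 := c.conn.dist_triangle (u := p 3) (v := w) (w := q)
    have h3 := SimpleGraph.dist_eq_one_iff_adj.2 hq
    omega) hζ
  have hζx := c.ballStab_one_le_arcStab hx.symm hζ2
  rw [arcStab_comm] at hζx
  have hQw : Zsub Γ G (p 2) ≤ ballStab Γ G w 1 := c.le_of_dist (by
    have h1 := c.dist_le_add_one hp hw (i := 2) (by omega)
    omega)
  obtain ⟨s, hs, hs'⟩ := c.exists_reflection hw
  obtain ⟨z, hz, hr⟩ := c.exists_commutator_ne_one hw hs hs'
  obtain ⟨f, hf1, hf2⟩ := c.exists_stabilizer_smul_eq hw.symm hq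
  have a1 := conj_mem_arcStab f hs
  have a2 := c.conj_mem_Zsub f hz
  rw [mem_stabilizer_iff.1 hf1, hf2] at a1
  rw [hf2] at a2
  have hcw := fun {g} => c.commute_commutator (g := g) hw.symm hs hz
  have h1 := c.commutator_mem_of_notMem hq hx hζ hζx hζ' hQw a1 a2
  rw [← conjugate_commutatorElement, (hcw hf1).eq, mul_inv_cancel_right] at h1
  have h2 := c.commute_Zsub
    (c.le_of_path hp (by omega) (by omega) (by omega) (by omega) htZ) h1
  have h3 := c.commutator_mem_Zuw hw hs hz
  have hcv := c.commute_stabilizer hw hvy ht ht' hne h3 h2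
  have hbot := c.eq_bot_of_normalized hw (N := Subgroup.zpowers ⁅s, z⁆)
    (Subgroup.zpowers_le.2 (mem_Zuw.1 h3).1) ?_ ?_
  · exact hr (Subgroup.zpowers_eq_bot.1 hbot)
  · rintro g hg _ ⟨n, rfl⟩
    refine ⟨n, ?_⟩
    dsimp only
    rw [((hcv g hg).zpow_right n).eq, mul_inv_cancel_right]
  · rintro g hg _ ⟨n, rfl⟩
    refine ⟨n, ?_⟩
    dsimp only
    rw [((hcw hg).zpow_right n).eq, mul_inv_cancel_right]

end HasCriticalDist

namespace IsLocallyReflective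

/-- The critical distance is at most 2. -/
theorem exists_dist_le_two (h : IsLocallyReflective Γ G)
    (hZ : ∀ u w, Γ.Adj u w → Zuw G u w ≠ ⊥) (v₀ : α) :
    ∃ u v, Γ.dist u v ≤ 2 ∧ ¬ Zsub Γ G u ≤ ballStab Γ G v 1 ∧
      ∀ u' v', Γ.dist u' v' < Γ.dist u v → Zsub Γ G u' ≤ ballStab Γ G v' 1 := by
  classical
  have hex : ∃ d, ∃ u v, Γ.dist u v = d ∧ ¬ Zsub Γ G u ≤ ballStab Γ G v 1 := by
    by_contra! hall
    obtain ⟨w, hw⟩ := h.exists_adj v₀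
    refine hZ v₀ w hw (eq_bot_iff.2 fun x hx => h.faith x fun z => ?_)
    exact ((mem_ballStab_one h.conn).1 (hall _ v₀ z rfl (Zuw_le_Zsub hw hx))).1
  have hmin : ∀ u' v', Γ.dist u' v' < Nat.find hex → Zsub Γ G u' ≤ ballStab Γ G v' 1 :=
    fun u' v' hd => by
      by_contra hle
      exact Nat.find_min hex hd ⟨u', v', rfl, hle⟩
  obtain ⟨u, v, hd, hle⟩ := Nat.find_spec hex
  rw [← hd] at hmin
  refine ⟨u, v, ?_, hle, hmin⟩
  by_contra! h3
  obtain ⟨k, hk⟩ := Nat.exists_eq_add_of_lt h3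
  obtain ⟨p, hp⟩ := h.conn.exists_walk_length_eq_dist u v
  replace hk : Γ.dist u v = k + 3 := by omega
  have hc : HasCriticalDist Γ G k :=
    { h with
      Zuw_ne := fun {u w} hw => hZ u w hw
      le_of_dist := fun {u' v'} hd => hmin u' v' (hk ▸ hd)
      exists_path := ⟨p.getVert, fun i hi => p.adj_getVert_succ (by omega), by
        rwa [SimpleGraph.Walk.getVert_zero, ← hk, ← hp, SimpleGraph.Walk.getVert_length]⟩ }
  exact hc.elim_false

/-- Every arc stabilizer contains a reflection centralizing `G_v^{[3]}`. -/
theorem exists_reflection_commute (h : IsLocallyReflective Γ G)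
    (hZ : ∀ u w, Γ.Adj u w → Zuw G u w ≠ ⊥) {v m : α} (hm : Γ.Adj v m) :
    ∃ t ∈ arcStab G v m, t ∉ ballStab Γ G v 1 ∧ ∀ x ∈ ballStab Γ G v 3, Commute t x := by
  obtain ⟨u, v', hd, hle, hmin⟩ := h.exists_dist_le_two hZ v
  obtain ⟨y, hy, t, htZ, ht, ht'⟩ : ∃ y, Γ.Adj v' y ∧ ∃ t ∈ Zsub Γ G u, t ∈ arcStab G v' y ∧
      t ∉ ballStab Γ G v' 1 := by
    by_cases huv : u = v'
    · subst huv
      by_contra! hcon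
      exact hle (Zsub_le (fun w hw x hx =>
        hcon w hw x (Zuw_le_Zsub hw hx) (mem_Zuw.1 hx).1) h.aut)
    · obtain ⟨t, ht, ht'⟩ := Set.not_subset.1 hle
      obtain ⟨p, hp⟩ := h.conn.exists_walk_length_eq_dist v' u
      cases p with
      | nil => exact absurd rfl huv
      | @cons _ y _ hadj p =>
        have h1 := SimpleGraph.dist_le p
        rw [SimpleGraph.Walk.length_cons, SimpleGraph.dist_comm] at hp
        have h2 := h.ballStab_one_le_arcStab hadj.symm (hmin u y (by
          rw [SimpleGraph.dist_comm]; omega) ht)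
        exact ⟨y, hadj, t, ht, ⟨h2.2, h2.1⟩, ht'⟩
  obtain ⟨g, rfl, rfl⟩ := h.arc _ _ _ _ hy hm
  refine ⟨_, conj_mem_arcStab g ht, h.notMem_conj_ballStab g ht', fun x hx => ?_⟩
  have h1 := h.conj_mem_ballStab g⁻¹ hx
  rw [inv_smul_smul] at h1
  have h2 := h.commute_Zsub (h.ballStab_le (r := 1) (by rw [SimpleGraph.dist_comm]; omega) h1) htZ
  simpa [mul_assoc] using h2.symm.map (MulAut.conj g)

theorem ballStab_inf_eq_bot (h : IsLocallyReflective Γ G)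
    (hZ : ∀ u w, Γ.Adj u w → Zuw G u w ≠ ⊥) {v w : α} (hw : Γ.Adj v w) :
    ballStab Γ G v 3 ⊓ ballStab Γ G w 3 = ⊥ := by
  have hdist := SimpleGraph.dist_eq_one_iff_adj.2 hw
  refine h.eq_bot_of_symm (N := fun v w => ballStab Γ G v 3 ⊓ ballStab Γ G w 3)
    (fun _ _ => inf_comm _ _)
    (fun g _ _ _ hx => ⟨h.conj_mem_ballStab g hx.1, h.conj_mem_ballStab g hx.2⟩) hw
    (inf_le_left.trans ((h.ballStab_le (by simp)).trans (h.ballStab_one_le_arcStab hw))) ?_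
  have hle : stabilizer G v ≤
      Subgroup.normalizer (ballStab Γ G v 3 ⊓ ballStab Γ G w 3 : Subgroup G) := by
    refine h.stabilizer_le hw (fun g hg => ?_) fun m hm => ?_
    · have hconj : ∀ g ∈ arcStab G v w, ∀ x ∈ ballStab Γ G v 3 ⊓ ballStab Γ G w 3,
          g * x * g⁻¹ ∈ ballStab Γ G v 3 ⊓ ballStab Γ G w 3 := fun g hg x hx =>
        ⟨h.conj_mem_ballStab_self hg.1 hx.1, h.conj_mem_ballStab_self hg.2 hx.2⟩
      refine Subgroup.mem_normalizer_iff.2 fun x => ⟨hconj g hg x, fun hx => ?_⟩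
      have := hconj _ (inv_mem hg) _ hx
      simpa [mul_assoc] using this
    · obtain ⟨t, ht, ht', hc⟩ := h.exists_reflection_commute hZ hm
      refine ⟨t, Subgroup.mem_normalizer_iff.2 fun x => ⟨fun hx => ?_, fun hx => ?_⟩, ht, ht'⟩
      · rwa [(hc x hx.1).eq, mul_inv_cancel_right]
      · have h1 := (hc _ hx.1).eq
        rw [inv_mul_cancel_right, mul_right_inj] at h1
        rwa [h1] at hx
  exact fun g hg x hx => (Subgroup.mem_normalizer_iff.1 (hle hg) x).1 hx

theorem ballStab_eq_bot (h : IsLocallyReflective Γ G) (u : α) : ballStab Γ G u 4 = ⊥ := by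
  obtain ⟨w, hw⟩ := h.exists_adj u
  have hd := SimpleGraph.dist_eq_one_iff_adj.2 hw
  by_cases hS : arcStab G u w = ⊥
  · exact eq_bot_iff.2 (((h.ballStab_le (by simp)).trans (h.ballStab_one_le_arcStab hw)).trans
      hS.le)
  · refine eq_bot_iff.2 (le_trans (le_inf (h.ballStab_le (by simp)) (h.ballStab_le (by omega)))
      (h.ballStab_inf_eq_bot (fun u' w' hw' => h.Zuw_ne_bot hw' fun hS' => hS ?_) hw).le)
    obtain ⟨g, rfl, rfl⟩ := h.arc _ _ _ _ hw hw'
    refine eq_bot_iff.2 fun x hx => ?_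
    have := conj_mem_arcStab g hx
    rw [hS'] at this
    simpa using this

end IsLocallyReflective

end LocallyReflective

/-- for every vertex `u`, the pointwise stabilizer `G_u^{[4]}` of the
ball of radius 4 around `u` is trivial. -/
theorem ballStab_four_eq_bot
    {α : Type*} (n : ℕ) (hn : 2 ≤ n) (Γ : SimpleGraph α)
    (G : Type*) [Group G] [MulAction G α]
    (hconn : Γ.Connected) (hacyc : Γ.IsAcyclic)
    (haut : ∀ (g : G) (u w : α), Γ.Adj u w ↔ Γ.Adj (g • u) (g • w))
    (hfaith : ∀ g : G, (∀ u : α, g • u = u) → g = 1)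
    (harc : ∀ u w u' w' : α, Γ.Adj u w → Γ.Adj u' w' → ∃ g : G, g • u = u' ∧ g • w = w')
    (hfin : ∀ u : α, Finite (stabilizer G u))
    (hloc : LocallyL n Γ G)
 :
    ∀ u : α, ballStab Γ G u 4 = ⊥ := by
  exact (LocallyL.isLocallyReflective (by omega) hconn haut hfaith harc hfin
    hloc).ballStab_eq_bot
end

section
/- Assume the critical distance satisfies b > 2. Then for every vertex t ∈ Γ(x) with t ≠ x+1 and Z_t ≤ Q_{v−1} (equivalently, (t, v−1) is not a critical pair), one has Z_t Z_x = Z_x Z_{x+1}. -/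
open MulAction Pointwise

/-- The standing assumptions: `Γ` is connected, `G` acts faithfully and arc-transitively on `Γ`
with finite vertex stabilizers, `(Γ, G)` is locally `L`, and some edge has a nontrivial pointwise
stabilizer of its neighbourhood. -/
structure IsLocallyFrobenius {α : Type*} (n : ℕ) (Γ : SimpleGraph α) (G : Type*) [Group G]
    [MulAction G α] : Prop where
  conn : Γ.Connected
  aut : ∀ (g : G) (u w : α), Γ.Adj u w ↔ Γ.Adj (g • u) (g • w)
  faith : ∀ g : G, (∀ u : α, g • u = u) → g = 1
  arc : ∀ u w u' w' : α, Γ.Adj u w → Γ.Adj u' w' → ∃ g : G, g • u = u' ∧ g • w = w'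
  fin : ∀ u : α, Finite (stabilizer G u)
  loc : LocallyL n Γ G
  exists_edge : ∃ u w : α, Γ.Adj u w ∧ ballStab Γ G u 1 ⊓ ballStab Γ G w 1 ≠ ⊥

theorem mem_Lgrp_cases {n : ℕ} {l : Equiv.Perm (Vec n)} (hl : l ∈ Lgrp n) :
    (∃ c, ∀ v, l v = v + c) ∨ (∃ c, ∀ v, l v = c - v) := by
  induction hl using Subgroup.closure_induction with
  | mem l hl =>
    rcases hl with ⟨w, hw⟩ | hl
    · exact .inl ⟨w, hw⟩
    · refine .inr ⟨0, fun v => ?_⟩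
      rw [Set.mem_singleton_iff.1 hl]
      simp
  | one => exact .inl ⟨0, fun v => by simp⟩
  | mul a b _ _ ha hb =>
    rcases ha with ⟨c, hc⟩ | ⟨c, hc⟩ <;> rcases hb with ⟨d, hd⟩ | ⟨d, hd⟩
    · exact .inl ⟨d + c, fun v => by rw [Equiv.Perm.mul_apply, hd, hc]; abel⟩
    · exact .inr ⟨d + c, fun v => by rw [Equiv.Perm.mul_apply, hd, hc]; abel⟩
    · exact .inr ⟨c - d, fun v => by rw [Equiv.Perm.mul_apply, hd, hc]; abel⟩
    · exact .inl ⟨c - d, fun v => by rw [Equiv.Perm.mul_apply, hd, hc]; abel⟩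
  | inv a _ ha =>
    rcases ha with ⟨c, hc⟩ | ⟨c, hc⟩
    · exact .inl ⟨-c, fun v => by rw [Equiv.Perm.inv_eq_iff_eq, hc]; abel⟩
    · exact .inr ⟨c, fun v => by rw [Equiv.Perm.inv_eq_iff_eq, hc]; abel⟩

theorem addRight_mem_Lgrp {n : ℕ} (c : Vec n) : Equiv.addRight c ∈ Lgrp n :=
  Subgroup.subset_closure (.inl ⟨c, fun _ => rfl⟩)

theorem subLeft_mem_Lgrp {n : ℕ} (c : Vec n) : Equiv.subLeft c ∈ Lgrp n := by
  have : Equiv.subLeft c = Equiv.addRight c * Equiv.neg (Vec n) := by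
    ext v
    simp [sub_eq_neg_add]
  rw [this]
  exact mul_mem (addRight_mem_Lgrp c) (Subgroup.subset_closure (.inr rfl))

namespace IsLocallyFrobenius

variable {α : Type*} {n : ℕ} {Γ : SimpleGraph α} {G : Type*} [Group G] [MulAction G α]

/-- Coordinates on the neighbourhood of a vertex `u` in which the stabilizer of `u` acts by
translations and point reflections. -/
theorem exists_coord (H : IsLocallyFrobenius n Γ G) (u : α) :
    ∃ f : α → Vec n, (∀ s s', Γ.Adj u s → Γ.Adj u s' → f s = f s' → s = s') ∧
      (∀ g ∈ stabilizer G u, (∃ c, ∀ s, Γ.Adj u s → f (g • s) = f s + c) ∨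
        (∃ c, ∀ s, Γ.Adj u s → f (g • s) = c - f s)) ∧
      (∀ c, ∃ g ∈ stabilizer G u, ∀ s, Γ.Adj u s → f (g • s) = f s + c) ∧
      (∀ c, ∃ g ∈ stabilizer G u, ∀ s, Γ.Adj u s → f (g • s) = c - f s) := by
  classical
  obtain ⟨φ, h1, h2⟩ := H.loc u
  let f : α → Vec n := fun s => if h : s ∈ Γ.neighborSet u then φ ⟨s, h⟩ else 0
  have hf (s : α) (h : s ∈ Γ.neighborSet u) : f s = φ ⟨s, h⟩ := dif_pos h
  have key (g : G) (l : Equiv.Perm (Vec n)) (hg : ∀ z : Γ.neighborSet u,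
      ∃ hz : (g • (z : α)) ∈ Γ.neighborSet u, φ ⟨g • (z : α), hz⟩ = l (φ z))
      (s : α) (hs : Γ.Adj u s) : f (g • s) = l (f s) := by
    obtain ⟨hz, e⟩ := hg ⟨s, hs⟩
    rw [hf _ hz, hf s hs, e]
  refine ⟨f, fun s s' hs hs' e => ?_, fun g hg => ?_, fun c => ?_, fun c => ?_⟩
  · rw [hf s hs, hf s' hs'] at e
    exact congrArg Subtype.val (φ.injective e)
  · obtain ⟨l, hl, h⟩ := h1 g hg
    rcases mem_Lgrp_cases hl with ⟨c, hc⟩ | ⟨c, hc⟩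
    · exact .inl ⟨c, fun s hs => by rw [key g l h s hs, hc]⟩
    · exact .inr ⟨c, fun s hs => by rw [key g l h s hs, hc]⟩
  · obtain ⟨g, hg, h⟩ := h2 _ (addRight_mem_Lgrp c)
    exact ⟨g, hg, fun s hs => key g _ h s hs⟩
  · obtain ⟨g, hg, h⟩ := h2 _ (subLeft_mem_Lgrp c)
    exact ⟨g, hg, fun s hs => key g _ h s hs⟩

theorem adj_smul (H : IsLocallyFrobenius n Γ G) {g : G} {u s : α} (hg : g • u = u)
    (hs : Γ.Adj u s) : Γ.Adj u (g • s) := by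
  have := (H.aut g u s).1 hs
  rwa [hg] at this

theorem mem_ballStab_one (H : IsLocallyFrobenius n Γ G) {g : G} {u : α} :
    g ∈ ballStab Γ G u 1 ↔ g • u = u ∧ ∀ s, Γ.Adj u s → g • s = s := by
  simp only [ballStab, Subgroup.mem_iInf, mem_stabilizer_iff, Set.mem_ofPred_eq]
  refine ⟨fun h => ⟨h u (by simp), fun s hs => h s (SimpleGraph.dist_eq_one_iff_adj.2 hs).le⟩,
    fun h s hs => ?_⟩
  rcases Nat.le_one_iff_eq_zero_or_eq_one.1 hs with h0 | h1
  · rw [← (H.conn.dist_eq_zero_iff).1 h0]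
    exact h.1
  · exact h.2 s (SimpleGraph.dist_eq_one_iff_adj.1 h1)

/-- An element of an arc stabilizer acting nontrivially on the neighbourhood of the first vertex
acts as a point reflection. -/
theorem reflection_of_notMem (H : IsLocallyFrobenius n Γ G) {g : G} {u w : α} (hw : Γ.Adj u w)
    {f : α → Vec n} (hinj : ∀ s s', Γ.Adj u s → Γ.Adj u s' → f s = f s' → s = s')
    (hf : ∀ g ∈ stabilizer G u, (∃ c, ∀ s, Γ.Adj u s → f (g • s) = f s + c) ∨
        (∃ c, ∀ s, Γ.Adj u s → f (g • s) = c - f s))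
    (hgu : g • u = u) (hgw : g • w = w) (hg : g ∉ ballStab Γ G u 1) :
    ∀ s, Γ.Adj u s → f (g • s) = f w + f w - f s := by
  rcases hf g hgu with ⟨c, hc⟩ | ⟨c, hc⟩
  · refine absurd (H.mem_ballStab_one.2 ⟨hgu, fun s hs => ?_⟩) hg
    have hc0 : c = 0 := by
      have := hc w hw
      rwa [hgw, left_eq_add] at this
    refine hinj _ _ (H.adj_smul hgu hs) hs ?_
    rw [hc s hs, hc0, add_zero]
  · have hcw : c = f w + f w := by
      have := hc w hw
      rw [hgw] at this
      exact (sub_eq_iff_eq_add.1 this.symm)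
    exact hcw ▸ hc

theorem mul_mem_ballStab (H : IsLocallyFrobenius n Γ G) {g h : G} {u w : α} (hw : Γ.Adj u w)
    (hgu : g • u = u) (hgw : g • w = w) (hg : g ∉ ballStab Γ G u 1)
    (hhu : h • u = u) (hhw : h • w = w) (hh : h ∉ ballStab Γ G u 1) :
    g * h ∈ ballStab Γ G u 1 := by
  obtain ⟨f, hinj, hf, -, -⟩ := H.exists_coord u
  refine H.mem_ballStab_one.2 ⟨by rw [mul_smul, hhu, hgu], fun s hs => ?_⟩
  have hs' := H.adj_smul hhu hs
  rw [mul_smul]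
  refine hinj _ _ (H.adj_smul hgu hs') hs ?_
  rw [H.reflection_of_notMem hw hinj hf hgu hgw hg _ hs',
    H.reflection_of_notMem hw hinj hf hhu hhw hh _ hs]
  abel

theorem exists_fix_smul_eq (H : IsLocallyFrobenius n Γ G) {z : G} {u w t : α} (hw : Γ.Adj u w)
    (ht : Γ.Adj u t) (hzu : z • u = u) (hzw : z • w = w) (hz : z ∉ ballStab Γ G u 1) :
    ∃ r : G, r • u = u ∧ r • t = t ∧ r • z • t = w := by
  obtain ⟨f, hinj, hf, -, hr⟩ := H.exists_coord u
  obtain ⟨r, hru, hr⟩ := hr (f t + f t)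
  have hzt := H.adj_smul hzu ht
  refine ⟨r, hru, hinj _ _ (H.adj_smul hru ht) ht ?_, hinj _ _ (H.adj_smul hru hzt) hw ?_⟩
  · rw [hr t ht, add_sub_cancel_right]
  · rw [hr _ hzt, H.reflection_of_notMem hw hinj hf hzu hzw hz _ ht]
    have h3 : ∀ a b : ZMod 3, a + a - (b + b - a) = b := by decide
    ext i
    exact h3 (f t i) (f w i)

theorem exists_conj_smul_eq (H : IsLocallyFrobenius n Γ G) {z : G} {u w s s' : α}
    (hw : Γ.Adj u w) (hs : Γ.Adj u s) (hs' : Γ.Adj u s')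
    (hzu : z • u = u) (hzw : z • w = w) (hz : z ∉ ballStab Γ G u 1) :
    ∃ h : G, h • u = u ∧ (h * z * h⁻¹) • s = s' := by
  obtain ⟨f, hinj, hf, hr, -⟩ := H.exists_coord u
  obtain ⟨h, hhu, hh⟩ := hr (-(f s + f s') - f w)
  have hhu' : h⁻¹ • u = u := inv_smul_eq_iff.2 hhu.symm
  have h1 := H.adj_smul hhu' hs
  have h2 := H.adj_smul hzu h1
  refine ⟨h, hhu, ?_⟩
  rw [mul_smul, mul_smul]
  refine hinj _ _ (H.adj_smul hhu h2) hs' ?_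
  have e := hh _ h1
  rw [smul_inv_smul] at e
  rw [hh _ h2, H.reflection_of_notMem hw hinj hf hzu hzw hz _ h1, eq_sub_of_add_eq e.symm]
  have h3 : ∀ a b c : ZMod 3,
      a + a - (b - (-(b + c) - a)) + (-(b + c) - a) = c := by decide
  ext i
  exact h3 (f w i) (f s i) (f s' i)

theorem conj_mem_ballStab (H : IsLocallyFrobenius n Γ G) (h : G) {g : G} {u : α}
    (hg : g ∈ ballStab Γ G u 1) : h * g * h⁻¹ ∈ ballStab Γ G (h • u) 1 := by
  rw [H.mem_ballStab_one] at hg ⊢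
  refine ⟨by simp [mul_smul, hg.1], fun s hs => ?_⟩
  have : Γ.Adj u (h⁻¹ • s) := by
    rw [H.aut h, smul_inv_smul]
    exact hs
  rw [mul_smul, mul_smul, hg.2 _ this, smul_inv_smul]

theorem ballStab_inf_ballStab_ne_bot (H : IsLocallyFrobenius n Γ G) {u w : α} (hw : Γ.Adj u w) :
    ballStab Γ G u 1 ⊓ ballStab Γ G w 1 ≠ ⊥ := by
  obtain ⟨x, y, hxy, hne⟩ := H.exists_edge
  obtain ⟨g, rfl, rfl⟩ := H.arc x y u w hxy hw
  obtain ⟨k, hk, hk1⟩ := (Subgroup.bot_or_exists_ne_one _).resolve_left hne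
  intro hbot
  have hmem : g * k * g⁻¹ ∈ ballStab Γ G (g • x) 1 ⊓ ballStab Γ G (g • y) 1 :=
    ⟨H.conj_mem_ballStab g hk.1, H.conj_mem_ballStab g hk.2⟩
  rw [hbot, Subgroup.mem_bot, conj_eq_one_iff] at hmem
  exact hk1 hmem

/-- A subgroup of a vertex stabilizer `G_u` that is normalized by `G_u` and by an element
reversing an edge at `u` is trivial. -/
theorem eq_bot_of_normalized (H : IsLocallyFrobenius n Γ G) {u w : α} (hw : Γ.Adj u w)
    {K : Subgroup G} (hK : ∀ k ∈ K, k • u = u)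
    (hn : ∀ g : G, g • u = u → ∀ k ∈ K, g⁻¹ * k * g ∈ K) {r : G} (hru : r • u = w)
    (hr : ∀ k ∈ K, r⁻¹ * k * r ∈ K) : K = ⊥ := by
  have key (s : α) (p : Γ.Walk s u) : ∃ m : G, m • u = s ∧ ∀ k ∈ K, m⁻¹ * k * m ∈ K := by
    induction p with
    | nil => exact ⟨1, one_smul _ _, fun k hk => by simpa using hk⟩
    | @cons s s' u hadj p ih =>
      obtain ⟨m, hm, hmK⟩ := ih hw hK hn hru
      have hs : Γ.Adj u (m⁻¹ • s) := by
        rw [H.aut m, smul_inv_smul, hm]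
        exact hadj.symm
      obtain ⟨g, hgu, hgw⟩ := H.arc u w u (m⁻¹ • s) hw hs
      refine ⟨m * g * r, ?_, fun k hk => ?_⟩
      · rw [mul_smul, mul_smul, hru, hgw, smul_inv_smul]
      · have := hr _ (hn g hgu _ (hmK k hk))
        simpa [mul_assoc] using this
  refine (Subgroup.eq_bot_iff_forall K).2 fun k hk => H.faith k fun s => ?_
  obtain ⟨p⟩ := H.conn.preconnected s u
  obtain ⟨m, hm, hmK⟩ := key s p
  have := hK _ (hmK k hk)
  rw [mul_smul, mul_smul, hm, inv_smul_eq_iff, hm] at this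
  exact this

theorem Zuw_conj (h : G) {g : G} {u w : α} (hg : g ∈ Zuw G u w) :
    h * g * h⁻¹ ∈ Zuw G (h • u) (h • w) := by
  have hle : Zuw G u w ≤ (Zuw G (h • u) (h • w)).comap (MulAut.conj h).toMonoidHom := by
    refine (Subgroup.closure_le _).2 fun g hg => Subgroup.subset_closure ?_
    obtain ⟨⟨⟨h1, h2⟩, h3⟩, h4⟩ := hg
    replace h1 : g • u = u := h1
    replace h2 : g • w = w := h2
    refine ⟨⟨⟨?_, ?_⟩, ?_⟩, ?_⟩
    · simp [mul_smul, h1]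
    · simp [mul_smul, h2]
    · intro k hk
      have hk1 : k • h • u = h • u := hk.1
      have hk2 : k • h • w = h • w := hk.2
      have := h3 (h⁻¹ * k * h) ⟨by simp [mul_smul, hk1], by simp [mul_smul, hk2]⟩
      have := congrArg (fun a => h * a * h⁻¹) this
      simpa [mul_assoc] using this
    · simp only [MulEquiv.toMonoidHom_eq_coe, MonoidHom.coe_coe, MulAut.conj_apply, conj_pow, h4]
      simp
  exact hle hg

theorem Zuw_comm (u w : α) : Zuw G u w = Zuw G w u := by
  simp only [Zuw, inf_comm (stabilizer G u)]

theorem Zuw_le_arc (u w : α) : Zuw G u w ≤ stabilizer G u ⊓ stabilizer G w :=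
  (Subgroup.closure_le _).2 fun _ hg => hg.1.1

theorem Zuw_le_centralizer (u w : α) : Zuw G u w ≤
    Subgroup.centralizer ((stabilizer G u ⊓ stabilizer G w : Subgroup G) : Set G) :=
  (Subgroup.closure_le _).2 fun _ hg => hg.1.2

theorem ballStab_le_arc (H : IsLocallyFrobenius n Γ G) {u w : α} (hw : Γ.Adj u w) :
    ballStab Γ G u 1 ≤ stabilizer G u ⊓ stabilizer G w := fun _ hg =>
  ⟨(H.mem_ballStab_one.1 hg).1, (H.mem_ballStab_one.1 hg).2 w hw⟩

theorem Zuw_le_ballStab (H : IsLocallyFrobenius n Γ G) {u w : α} (hw : Γ.Adj u w) :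
    Zuw G u w ≤ ballStab Γ G u 1 := by
  intro z hz
  by_contra hzQ
  have hzuw := Zuw_le_arc u w hz
  have hcomm (h : G) (hh : h • u = u) (k : G) (hk : k ∈ ballStab Γ G u 1) :
      (h * z * h⁻¹) * k * (h * z * h⁻¹)⁻¹ = k := by
    have hk' := H.conj_mem_ballStab h⁻¹ hk
    rw [inv_smul_eq_iff.2 hh.symm] at hk'
    have e := Zuw_le_centralizer u w hz _ (H.ballStab_le_arc hw hk')
    have e' := congrArg (fun a => h * a * z⁻¹ * h⁻¹) e
    simp only [inv_inv] at e'
    calc _ = h * (z * (h⁻¹ * k * h)) * z⁻¹ * h⁻¹ := by group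
      _ = k := by rw [← e']; group
  have hall (s s' : α) (hs : Γ.Adj u s) (hs' : Γ.Adj u s') :
      ballStab Γ G u 1 ⊓ ballStab Γ G s 1 ≤ ballStab Γ G u 1 ⊓ ballStab Γ G s' 1 := by
    rintro k ⟨hk1, hk2⟩
    obtain ⟨h, hh, e⟩ := H.exists_conj_smul_eq hw hs hs' hzuw.1 hzuw.2 hzQ
    refine ⟨hk1, ?_⟩
    have := H.conj_mem_ballStab (h * z * h⁻¹) hk2
    rwa [e, hcomm h hh k hk1] at this
  obtain ⟨r, hru, hrw⟩ := H.arc u w w u hw hw.symm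
  refine H.ballStab_inf_ballStab_ne_bot hw (H.eq_bot_of_normalized hw
    (fun k hk => (H.mem_ballStab_one.1 hk.1).1)
    (fun g hg k hk => ?_) hru fun k hk => ?_)
  · have hg' : g⁻¹ • u = u := inv_smul_eq_iff.2 hg.symm
    have h1 := H.conj_mem_ballStab g⁻¹ hk.1
    have h2 := H.conj_mem_ballStab g⁻¹ hk.2
    rw [inv_inv] at h1 h2
    rw [hg'] at h1
    exact hall _ _ (H.adj_smul hg' hw) hw ⟨h1, h2⟩
  · have h1 := H.conj_mem_ballStab r⁻¹ hk.1
    have h2 := H.conj_mem_ballStab r⁻¹ hk.2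
    rw [inv_inv] at h1 h2
    rw [inv_smul_eq_iff.2 hrw.symm] at h1
    rw [inv_smul_eq_iff.2 hru.symm] at h2
    exact ⟨h2, h1⟩

theorem Zsub_conj (H : IsLocallyFrobenius n Γ G) (h : G) {g : G} {u : α}
    (hg : g ∈ Zsub Γ G u) : h * g * h⁻¹ ∈ Zsub Γ G (h • u) := by
  have hle : Zsub Γ G u ≤ (Zsub Γ G (h • u)).comap (MulAut.conj h).toMonoidHom := by
    refine (Subgroup.closure_le _).2 fun k hk => Subgroup.subset_closure ?_
    obtain ⟨a, ha, w, hw, g, hg, rfl⟩ := hk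
    have ha' : a • u = u := ha
    refine ⟨h * a * h⁻¹, by simp [mul_smul, ha'], h • w, (H.aut h u w).1 hw,
      h * g * h⁻¹, Zuw_conj h hg, ?_⟩
    simp [mul_assoc]
  exact hle hg

theorem Zuw_le_Zsub {u w : α} (hw : Γ.Adj u w) : Zuw G u w ≤ Zsub Γ G u := fun g hg =>
  Subgroup.subset_closure ⟨1, one_mem _, w, hw, g, hg, by simp⟩

theorem Zsub_le_ballStab (H : IsLocallyFrobenius n Γ G) (u : α) :
    Zsub Γ G u ≤ ballStab Γ G u 1 := by
  refine (Subgroup.closure_le _).2 fun k hk => ?_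
  obtain ⟨a, ha, w, hw, g, hg, rfl⟩ := hk
  have := H.conj_mem_ballStab a (H.Zuw_le_ballStab hw hg)
  rwa [ha] at this

theorem Zsub_le_centralizer (H : IsLocallyFrobenius n Γ G) (u : α) :
    Zsub Γ G u ≤ Subgroup.centralizer (ballStab Γ G u 1 : Set G) := by
  refine (Subgroup.closure_le _).2 fun k hk q hq => ?_
  obtain ⟨a, ha, w, hw, g, hg, rfl⟩ := hk
  have hq' := H.conj_mem_ballStab a⁻¹ hq
  rw [inv_smul_eq_iff.2 (Eq.symm ha)] at hq'
  have e := Zuw_le_centralizer u w hg _ (H.ballStab_le_arc hw hq')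
  have e' := congrArg (fun b => a * b * a⁻¹) e
  simpa [mul_assoc] using e'

theorem isPGroup_arc (H : IsLocallyFrobenius n Γ G) {u w : α} (hw : Γ.Adj u w) :
    IsPGroup 2 (stabilizer G u ⊓ stabilizer G w : Subgroup G) := by
  have hodd (g : G) (ho : Odd (orderOf g)) (s s' : α) (hs : Γ.Adj s s') (h1 : g • s = s)
      (h2 : g • s' = s') : g ∈ ballStab Γ G s 1 := by
    by_contra hg
    have hg2 : g ^ 2 ∈ ballStab Γ G s 1 := by
      rw [pow_two]
      exact H.mul_mem_ballStab hs h1 h2 hg h1 h2 hg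
    obtain ⟨k, hk⟩ := ho
    refine hg ?_
    have : g = (g ^ 2) ^ (k + 1) := by
      rw [← pow_mul, show 2 * (k + 1) = 2 * k + 1 + 1 by ring, ← hk, pow_succ, pow_orderOf_eq_one,
        one_mul]
    rw [this]
    exact pow_mem hg2 _
  have hone (g : G) (ho : Odd (orderOf g)) (h1 : g • u = u) (h2 : g • w = w) : g = 1 := by
    have key (s : α) (p : Γ.Walk s u) : g ∈ ballStab Γ G s 1 := by
      induction p with
      | nil => exact hodd g ho _ w hw h1 h2
      | @cons s s' u hadj p ih =>
        have := H.mem_ballStab_one.1 (ih hw h1)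
        exact hodd g ho s s' hadj (this.2 s hadj.symm) this.1
    refine H.faith g fun s => ?_
    obtain ⟨p⟩ := H.conn.preconnected s u
    exact (H.mem_ballStab_one.1 (key s p)).1
  rintro ⟨g, hg1, hg2⟩
  have hfin := H.fin u
  have hpos : 0 < orderOf g := by
    have := orderOf_pos (⟨g, hg1⟩ : stabilizer G u)
    rwa [Subgroup.orderOf_mk] at this
  obtain ⟨k, m, hm, e⟩ := Nat.exists_eq_two_pow_mul_odd hpos.ne'
  refine ⟨k, Subtype.ext ?_⟩
  have ho : orderOf (g ^ 2 ^ k) = m := by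
    rw [orderOf_pow_of_dvd (by positivity) (e ▸ Dvd.intro _ rfl), e,
      Nat.mul_div_cancel_left _ (by positivity)]
  exact hone (g ^ 2 ^ k) (ho ▸ hm) (pow_mem hg1 _) (pow_mem hg2 _)

theorem Zuw_ne_bot (H : IsLocallyFrobenius n Γ G) {u w : α} (hw : Γ.Adj u w) :
    Zuw G u w ≠ ⊥ := by
  have hfin := H.fin u
  have hP := H.isPGroup_arc hw
  have hle : ballStab Γ G u 1 ⊓ ballStab Γ G w 1 ≤ stabilizer G u ⊓ stabilizer G w :=
    inf_le_left.trans (H.ballStab_le_arc hw)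
  have : Finite (stabilizer G u ⊓ stabilizer G w : Subgroup G) :=
    Finite.of_injective _ (Subgroup.inclusion_injective
      (inf_le_left : stabilizer G u ⊓ stabilizer G w ≤ stabilizer G u))
  have : Nontrivial (stabilizer G u ⊓ stabilizer G w : Subgroup G) :=
    (Subgroup.nontrivial_iff_ne_bot _).2 fun h =>
      H.ballStab_inf_ballStab_ne_bot hw (le_bot_iff.1 (h ▸ hle))
  have hnt := hP.center_nontrivial
  have hZ : IsPGroup 2 (Subgroup.center (stabilizer G u ⊓ stabilizer G w : Subgroup G)) :=
    hP.to_subgroup _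
  have : Fact (Nat.Prime 2) := ⟨Nat.prime_two⟩
  obtain ⟨k, hk, hcard⟩ := hZ.nontrivial_iff_card.1 hnt
  obtain ⟨c, hc⟩ := exists_prime_orderOf_dvd_card' (G := Subgroup.center
    (stabilizer G u ⊓ stabilizer G w : Subgroup G)) 2 (hcard ▸ dvd_pow_self 2 hk.ne')
  intro hbot
  have hmem : ((c : (stabilizer G u ⊓ stabilizer G w : Subgroup G)) : G) ∈ Zuw G u w := by
    refine Subgroup.subset_closure ⟨⟨c.1.2, fun k hk => ?_⟩, ?_⟩
    · exact congrArg Subtype.val (Subgroup.mem_center_iff.1 c.2 ⟨k, hk⟩)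
    · have := pow_orderOf_eq_one c
      rw [hc] at this
      exact congrArg (fun a => a.1.1) this
  rw [hbot, Subgroup.mem_bot] at hmem
  have : c = 1 := Subtype.ext (Subtype.ext hmem)
  rw [this, orderOf_one] at hc
  omega

/-- An element of an arc stabilizer `G_{uw}` that centralizes `Z_u` lies in `G_u^{[1]}`. -/
theorem mem_ballStab_of_centralizes (H : IsLocallyFrobenius n Γ G) {u w : α} (hw : Γ.Adj u w)
    {z : G} (hzu : z • u = u) (hzw : z • w = w)
    (hz : z ∈ Subgroup.centralizer (Zsub Γ G u : Set G)) : z ∈ ballStab Γ G u 1 := by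
  by_contra hzQ
  have hcomm (h : G) (hh : h • u = u) (k : G) (hk : k ∈ Zsub Γ G u) :
      (h * z * h⁻¹) * k * (h * z * h⁻¹)⁻¹ = k := by
    have hk' := H.Zsub_conj h⁻¹ hk
    rw [inv_smul_eq_iff.2 hh.symm] at hk'
    have e := hz _ hk'
    have e' := congrArg (fun a => h * a * z⁻¹ * h⁻¹) e
    simp only [inv_inv] at e'
    calc _ = h * (z * (h⁻¹ * k * h)) * z⁻¹ * h⁻¹ := by group
      _ = k := by rw [← e']; group
  have hall (s s' : α) (hs : Γ.Adj u s) (hs' : Γ.Adj u s') : Zuw G u s ≤ Zuw G u s' := by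
    intro k hk
    obtain ⟨h, hh, e⟩ := H.exists_conj_smul_eq hw hs hs' hzu hzw hzQ
    have := Zuw_conj (h * z * h⁻¹) hk
    rw [e, hcomm h hh k (Zuw_le_Zsub hs hk)] at this
    rwa [mul_smul, mul_smul, inv_smul_eq_iff.2 hh.symm, hzu, hh] at this
  obtain ⟨r, hru, hrw⟩ := H.arc u w w u hw hw.symm
  refine H.Zuw_ne_bot hw (H.eq_bot_of_normalized hw (fun k hk => (Zuw_le_arc u w hk).1)
    (fun g hg k hk => ?_) hru fun k hk => ?_)
  · have hg' : g⁻¹ • u = u := inv_smul_eq_iff.2 hg.symm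
    have h1 := Zuw_conj g⁻¹ hk
    rw [inv_inv, hg'] at h1
    exact hall _ _ (H.adj_smul hg' hw) hw h1
  · have h1 := Zuw_conj r⁻¹ hk
    rw [inv_inv, inv_smul_eq_iff.2 hrw.symm, inv_smul_eq_iff.2 hru.symm] at h1
    rwa [Zuw_comm]

theorem Zsub_le_ballStab_of_dist_lt {u v : α} (h : Γ.dist u v < critDist Γ G) :
    Zsub Γ G u ≤ ballStab Γ G v 1 := by
  by_contra hn
  exact Nat.notMem_of_lt_sInf h ⟨u, v, rfl, hn⟩

theorem Zsub_conj_fix (H : IsLocallyFrobenius n Γ G) {h g : G} {u : α} (hh : h • u = u)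
    (hg : g ∈ Zsub Γ G u) : h * g * h⁻¹ ∈ Zsub Γ G u := by
  have := H.Zsub_conj h hg
  rwa [hh] at this

theorem Zsub_le_normalizer (H : IsLocallyFrobenius n Γ G) {x t : α} (ht : Γ.Adj x t) :
    Zsub Γ G t ≤ Subgroup.normalizer (Zsub Γ G x : Set G) := by
  intro h hh
  have hx : h • x = x := (H.ballStab_le_arc ht.symm (H.Zsub_le_ballStab t hh)).2
  refine Subgroup.mem_normalizer_iff.2 fun g => ⟨H.Zsub_conj_fix hx, fun hg => ?_⟩
  have := H.Zsub_conj_fix (inv_smul_eq_iff.2 hx.symm) hg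
  simpa [mul_assoc] using this

/-- For adjacent `t` and `x` the product set `Z_t Z_x` is the join of `Z_t` and `Z_x`. -/
theorem coe_Zsub_sup (H : IsLocallyFrobenius n Γ G) {x t : α} (ht : Γ.Adj x t) :
    ((Zsub Γ G t ⊔ Zsub Γ G x : Subgroup G) : Set G) = (Zsub Γ G t : Set G) * Zsub Γ G x := by
  refine Subgroup.coe_mul_of_left_le_normalizer_right _ _ (H.Zsub_le_normalizer ht)

/-- If `Z_x` and `Z_t` lie in `G_w^{[1]}` for a neighbour `w` of `v`, and `Z_x` acts nontrivially
on the neighbourhood of `v`, then the elements of `Z_v` fixing `x` normalize `Z_t Z_x`. -/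
theorem conj_mem_sup (H : IsLocallyFrobenius n Γ G) {x t v w : α} (hw : Γ.Adj v w)
    (hxw : Zsub Γ G x ≤ ballStab Γ G w 1) (htw : Zsub Γ G t ≤ ballStab Γ G w 1)
    (hx : ¬ Zsub Γ G x ≤ ballStab Γ G v 1) {z : G} (hz : z ∈ Zsub Γ G v) (hzx : z • x = x)
    {m : G} (hm : m ∈ Zsub Γ G t ⊔ Zsub Γ G x) :
    z * m * z⁻¹ ∈ Zsub Γ G t ⊔ Zsub Γ G x := by
  suffices h : Zsub Γ G t ⊔ Zsub Γ G x ≤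
      (Zsub Γ G t ⊔ Zsub Γ G x).comap (MulAut.conj z).toMonoidHom from h hm
  have hxle : Zsub Γ G x ≤ Zsub Γ G t ⊔ Zsub Γ G x := le_sup_right
  have htle : Zsub Γ G t ≤ Zsub Γ G t ⊔ Zsub Γ G x := le_sup_left
  refine sup_le (fun c hc => ?_) fun d hd => hxle (H.Zsub_conj_fix hzx hd)
  change z * c * z⁻¹ ∈ Zsub Γ G t ⊔ Zsub Γ G x
  have hcomm (q : G) (hq : q ∈ ballStab Γ G v 1) : z * q * z⁻¹ = q := by
    rw [← H.Zsub_le_centralizer v hz q hq, mul_inv_cancel_right]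
  by_cases hcv : c ∈ ballStab Γ G v 1
  · rw [hcomm c hcv]
    exact htle hc
  · obtain ⟨a, ha, hav⟩ := SetLike.not_le_iff_exists.1 hx
    have hcw := H.ballStab_le_arc hw.symm (htw hc)
    have haw := H.ballStab_le_arc hw.symm (hxw ha)
    have hca := hcomm _ (H.mul_mem_ballStab hw hcw.2 hcw.1 hcv haw.2 haw.1 hav)
    have e : z * c * z⁻¹ = z * (c * a) * z⁻¹ * (z * a * z⁻¹)⁻¹ := by group
    rw [e, hca]
    exact mul_mem (mul_mem (htle hc) (hxle ha)) (inv_mem (hxle (H.Zsub_conj_fix hzx ha)))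

end IsLocallyFrobenius

/-- if `b > 2`, then for every `t ∈ Γ(x)` with `t ≠ x+1` and
`Z_t ≤ Q_{v-1}` one has `Z_t Z_x = Z_x Z_{x+1}`. -/
theorem Zt_Zx_eq_Zx_Zy_of_noncritical
    {α : Type*} (n : ℕ) (hn : 2 ≤ n) (Γ : SimpleGraph α)
    (G : Type*) [Group G] [MulAction G α]
    (hconn : Γ.Connected) (hacyc : Γ.IsAcyclic)
    (haut : ∀ (g : G) (u w : α), Γ.Adj u w ↔ Γ.Adj (g • u) (g • w))
    (hfaith : ∀ g : G, (∀ u : α, g • u = u) → g = 1)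
    (harc : ∀ u w u' w' : α, Γ.Adj u w → Γ.Adj u' w' → ∃ g : G, g • u = u' ∧ g • w = w')
    (hfin : ∀ u : α, Finite (stabilizer G u))
    (hloc : LocallyL n Γ G)
    (x y : α) (hxy : Γ.Adj x y)
    (hntriv : ballStab Γ G x 1 ⊓ ballStab Γ G y 1 ≠ ⊥)
    (v : α) (hcrit : critPair Γ G x v)
    (b : ℕ) (hb : b = critDist Γ G)
    (p : ℕ → α) (hp0 : p 0 = x) (hpb : p b = v)
    (hpadj : ∀ i, i < b → Γ.Adj (p i) (p (i + 1)))
    (hy : y = p 1)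
    (hbgt : 2 < b)
    (t : α) (ht : t ∈ Γ.neighborSet x) (htne : t ≠ p 1)
    (htZ : Zsub Γ G t ≤ ballStab Γ G (p (b - 1)) 1) :
    (Zsub Γ G t : Set G) * (Zsub Γ G x : Set G) =
      (Zsub Γ G x : Set G) * (Zsub Γ G (p 1) : Set G) := by
  have H : IsLocallyFrobenius n Γ G := ⟨hconn, haut, hfaith, harc, hfin, hloc, x, y, hxy, hntriv⟩
  have hdist (i j : ℕ) (hij : i ≤ j) (hj : j ≤ b) : Γ.dist (p i) (p j) ≤ j - i := by
    induction j, hij using Nat.le_induction with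
    | base => simp
    | succ j hij ih =>
      have h1 := hconn.dist_triangle (u := p i) (v := p j) (w := p (j + 1))
      have h2 := SimpleGraph.dist_eq_one_iff_adj.2 (hpadj j (by omega))
      have := ih (by omega)
      omega
  have hx1 : Γ.Adj x (p 1) := hy ▸ hxy
  have hw : Γ.Adj v (p (b - 1)) := by
    have := hpadj (b - 1) (by omega)
    rw [Nat.sub_add_cancel (by omega), hpb] at this
    exact this.symm
  have hxw : Zsub Γ G x ≤ ballStab Γ G (p (b - 1)) 1 := by
    refine IsLocallyFrobenius.Zsub_le_ballStab_of_dist_lt ?_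
    have := hdist 0 (b - 1) (by omega) (by omega)
    rw [hp0] at this
    omega
  have hv1 : Zsub Γ G v ≤ ballStab Γ G (p 1) 1 := by
    refine IsLocallyFrobenius.Zsub_le_ballStab_of_dist_lt ?_
    have := hdist 1 b (by omega) le_rfl
    rw [hpb, SimpleGraph.dist_comm] at this
    omega
  have hvx : ¬ Zsub Γ G v ≤ ballStab Γ G x 1 := by
    intro hle
    obtain ⟨a, ha, hav⟩ := SetLike.not_le_iff_exists.1 hcrit.2
    have haw := H.ballStab_le_arc hw.symm (hxw ha)
    exact hav (H.mem_ballStab_of_centralizes hw haw.2 haw.1 fun q hq =>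
      H.Zsub_le_centralizer x ha q (hle hq))
  have hvarc (z : G) (hz : z ∈ Zsub Γ G v) : z • x = x :=
    (H.ballStab_le_arc hx1.symm (hv1 hz)).2
  obtain ⟨z, hz, hzQ⟩ := SetLike.not_le_iff_exists.1 hvx
  obtain ⟨r, hrx, hrt, hr⟩ := H.exists_fix_smul_eq hx1 ht (hvarc z hz)
    (H.ballStab_le_arc hx1.symm (hv1 hz)).1 hzQ
  have hsup (g : G) (hg : g • x = x) (m : G) (hm : m ∈ Zsub Γ G t ⊔ Zsub Γ G x) :
      g * m * g⁻¹ ∈ Zsub Γ G (g • t) ⊔ Zsub Γ G x := by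
    have hle : Zsub Γ G t ⊔ Zsub Γ G x ≤
        (Zsub Γ G (g • t) ⊔ Zsub Γ G x).comap (MulAut.conj g).toMonoidHom :=
      sup_le (fun c hc => Subgroup.mem_sup_left (H.Zsub_conj g hc))
        fun c hc => Subgroup.mem_sup_right (H.Zsub_conj_fix hg hc)
    exact hle hm
  have hrzx : (r * z) • x = x := by rw [mul_smul, hvarc z hz, hrx]
  have hrzt : (r * z) • t = p 1 := by rw [mul_smul, hr]
  have hrinv : r⁻¹ • t = t := inv_smul_eq_iff.2 hrt.symm
  have hrinvx : r⁻¹ • x = x := inv_smul_eq_iff.2 hrx.symm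
  have heq : Zsub Γ G t ⊔ Zsub Γ G x = Zsub Γ G (p 1) ⊔ Zsub Γ G x := by
    refine le_antisymm (fun m hm => ?_) (sup_le (fun c hc => ?_) le_sup_right)
    · have h1 := hsup _ hrinvx m hm
      rw [hrinv, inv_inv] at h1
      have h2 := H.conj_mem_sup hw hxw htZ hcrit.2 (inv_mem hz) (hvarc _ (inv_mem hz)) h1
      have h3 := hsup _ hrzx _ h2
      rw [hrzt] at h3
      convert h3 using 1
      group
    · have h1 := H.Zsub_conj (r * z)⁻¹ hc
      rw [inv_smul_eq_iff.2 hrzt.symm, inv_inv] at h1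
      have h2 := H.conj_mem_sup hw hxw htZ hcrit.2 hz (hvarc z hz) (Subgroup.mem_sup_left h1)
      have h3 := hsup r hrx _ h2
      rw [hrt] at h3
      convert h3 using 1
      group
  rw [← H.coe_Zsub_sup ht, heq, sup_comm]
  exact Subgroup.coe_mul_of_right_le_normalizer_left _ _ (H.Zsub_le_normalizer hx1)
end
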